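/- arXiv:2011.04724 — 8 statements merged into one kernel-verified Lean document; each statement's English description precedes it below -/
import Mathlib

section
/- For every R > 0, the function x ↦ ∫_{B̄_R(0)} ‖x − y‖⁻¹ dy (the Newtonian potential of the unit constant density on the closed ball B̄_R(0)) is finite at every point and is continuous on all of ℝ³. -/
open MeasureTheory Metric

lemma aux_loc (ρ : ℝ) : IntegrableOn (fun z : EuclideanSpace ℝ (Fin 3) => ‖z‖⁻¹) (ball 0 ρ) := by
  refine integrableOn_ball_of_norm_le_rpow (C := 1) (α := 1) (by simp) (by simp) ?_ ?_
  · refine Filter.Eventually.of_forall fun z => ?_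
    simp [Real.rpow_neg_one]
  · exact (measurable_norm.inv).aestronglyMeasurable

lemma aux_ind (R : ℝ) (x y : EuclideanSpace ℝ (Fin 3)) :
    (closedBall (0 : EuclideanSpace ℝ (Fin 3)) R).indicator (fun y => ‖x - y‖⁻¹) y
      = (closedBall x R).indicator (fun z => ‖z‖⁻¹) (x - y) := by
  have : y ∈ closedBall (0 : EuclideanSpace ℝ (Fin 3)) R ↔ x - y ∈ closedBall x R := by
    simp [dist_eq_norm]
  by_cases h : y ∈ closedBall (0 : EuclideanSpace ℝ (Fin 3)) R
  · rw [Set.indicator_of_mem h, Set.indicator_of_mem (this.1 h)]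
  · rw [Set.indicator_of_notMem h, Set.indicator_of_notMem (fun h' => h (this.2 h'))]

/-- For every `R > 0`, the Newtonian potential of the unit constant
density on the closed ball `B̄_R(0)` in `ℝ³`, i.e. `x ↦ ∫_{B̄_R(0)} ‖x - y‖⁻¹ dy`,
is finite at every point (the integrand is integrable on the ball for every `x`)
and is continuous on all of `ℝ³`. -/
theorem constant_density_potential_finite_and_continuous (R : ℝ) (hR : 0 < R) :
    (∀ x : EuclideanSpace ℝ (Fin 3),
        IntegrableOn (fun y => ‖x - y‖⁻¹) (closedBall (0 : EuclideanSpace ℝ (Fin 3)) R)) ∧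
    Continuous (fun x : EuclideanSpace ℝ (Fin 3) =>
        ∫ y in closedBall (0 : EuclideanSpace ℝ (Fin 3)) R, ‖x - y‖⁻¹) := by
  constructor
  · intro x
    rw [← integrable_indicator_iff measurableSet_closedBall]
    simp_rw [funext (aux_ind R x)]
    refine Integrable.comp_sub_left (f := (closedBall x R).indicator (fun z => ‖z‖⁻¹)) ?_ x
    rw [integrable_indicator_iff measurableSet_closedBall]
    refine (aux_loc (‖x‖ + R + 1)).mono_set (closedBall_subset_ball' ?_)
    rw [dist_zero_right]; linarith
  · have key : (fun x : EuclideanSpace ℝ (Fin 3) =>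
        ∫ y in closedBall (0 : EuclideanSpace ℝ (Fin 3)) R, ‖x - y‖⁻¹) =
        fun x => ∫ z, (closedBall x R).indicator (fun z => ‖z‖⁻¹) z := by
      funext x
      rw [← integral_indicator measurableSet_closedBall]
      simp_rw [aux_ind R x]
      exact integral_sub_left_eq_self ((closedBall x R).indicator (fun z => ‖z‖⁻¹)) volume x
    rw [key, continuous_iff_continuousAt]
    intro x₀
    refine continuousAt_of_dominated
      (bound := (ball (0 : EuclideanSpace ℝ (Fin 3)) (‖x₀‖ + R + 1)).indicator (fun z => ‖z‖⁻¹))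
      ?_ ?_ ?_ ?_
    · exact Filter.Eventually.of_forall fun x =>
        ((measurable_norm.inv).indicator measurableSet_closedBall).aestronglyMeasurable
    · filter_upwards [ball_mem_nhds x₀ one_pos] with x hx
      refine Filter.Eventually.of_forall fun z => ?_
      rw [Real.norm_of_nonneg (Set.indicator_nonneg (fun _ _ => by positivity) z)]
      refine Set.indicator_le_indicator_of_subset (closedBall_subset_ball' ?_)
        (fun _ => by positivity) z
      have := dist_triangle x x₀ 0
      rw [mem_ball] at hx
      rw [dist_zero_right x₀] at this
      linarith
    · rw [integrable_indicator_iff measurableSet_ball]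
      exact aux_loc _
    · have h0 : volume (sphere x₀ R) = 0 := Measure.addHaar_sphere _ _ _
      filter_upwards [measure_eq_zero_iff_ae_notMem.1 h0] with z hz
      have hc : Continuous fun x : EuclideanSpace ℝ (Fin 3) => dist z x := by fun_prop
      rcases lt_or_gt_of_ne (show dist z x₀ ≠ R from hz) with h | h
      · refine (continuousAt_const (y := ‖z‖⁻¹)).congr ?_
        filter_upwards [hc.continuousAt.eventually_lt_const h] with x hx
        rw [Set.indicator_of_mem (mem_closedBall.2 hx.le)]
      · refine (continuousAt_const (y := (0:ℝ))).congr ?_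
        filter_upwards [hc.continuousAt.eventually_const_lt h] with x hx
        rw [Set.indicator_of_notMem (fun h' => absurd (mem_closedBall.1 h') (not_le.2 hx))]
end

section
/- (Newton's theorem for smoothed point masses.) Let r > 0, m > 0, x₀ ∈ ℝ³, and let λ be an r-smoothing of the point mass (x₀, m). Then for every x ∈ ℝ³ with ‖x − x₀‖ ≥ r, the Newtonian potential satisfies V_λ(x) = m/‖x − x₀‖; i.e., outside its support the potential of λ coincides with the potential of the point mass (x₀, m). -/
open MeasureTheory Metric

/-- The Newtonian potential of a density `f` on `ℝ³`. -/
noncomputable def newtonPotential (f : EuclideanSpace ℝ (Fin 3) → ℝ)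
    (x : EuclideanSpace ℝ (Fin 3)) : ℝ :=
  ∫ y, f y / ‖x - y‖

/-- An `r`-smoothing of the point mass `(x₀, m)`: a continuous nonnegative density,
radially symmetric about `x₀`, whose (closed) support is the closed ball `B̄_r(x₀)`
and whose total mass is `m`. -/
def IsSmoothing (r m : ℝ) (x₀ : EuclideanSpace ℝ (Fin 3))
    (lam : EuclideanSpace ℝ (Fin 3) → ℝ) : Prop :=
  Continuous lam ∧ (∀ y, 0 ≤ lam y) ∧
    (∀ y z, ‖y - x₀‖ = ‖z - x₀‖ → lam y = lam z) ∧
    tsupport lam = closedBall x₀ r ∧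
    (∫ y, lam y) = m

lemma aux_polar (f : ℝ × ℝ → ENNReal) (hf : Measurable f) :
    ∫⁻ p, f p = ∫⁻ s in Set.Ioi (0:ℝ), ∫⁻ θ in Set.Ioo (-Real.pi) Real.pi,
      ENNReal.ofReal s * f (s * Real.cos θ, s * Real.sin θ) := by
  rw [← lintegral_comp_polarCoord_symm, polarCoord_target, Measure.volume_eq_prod,
    ← Measure.prod_restrict, lintegral_prod]
  · simp only [polarCoord_symm_apply, smul_eq_mul]
  · apply Measurable.aemeasurable
    simp only [polarCoord_symm_apply, smul_eq_mul]
    fun_prop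

lemma aux_cyl (F : ℝ → ℝ → ENNReal) (hF : Measurable (Function.uncurry F)) :
    ∫⁻ y : EuclideanSpace ℝ (Fin 3), F (y 0) (y 1 ^ 2 + y 2 ^ 2) =
      ∫⁻ a : ℝ, ∫⁻ p : ℝ × ℝ, F a (p.1 ^ 2 + p.2 ^ 2) := by
  have hF' : ∀ {α : Type} [MeasurableSpace α] (u v : α → ℝ), Measurable u → Measurable v →
      Measurable (fun t => F (u t) (v t)) := fun u v hu hv => hF.comp (hu.prodMk hv)
  have h1 := (EuclideanSpace.volume_preserving_symm_measurableEquiv_toLp (Fin 3)).lintegral_comp_emb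
    (MeasurableEquiv.measurableEmbedding _) (fun y : Fin 3 → ℝ => F (y 0) (y 1 ^ 2 + y 2 ^ 2))
  have h2 := (volume_preserving_piFinSuccAbove (fun _ : Fin 3 => ℝ) 0).lintegral_comp_emb
    (MeasurableEquiv.measurableEmbedding _)
    (fun q : ℝ × (Fin 2 → ℝ) => F q.1 (q.2 0 ^ 2 + q.2 1 ^ 2))
  have h3 : ∀ a : ℝ, _ := fun a => (volume_preserving_finTwoArrow ℝ).lintegral_comp_emb
    (MeasurableEquiv.measurableEmbedding _)
    (fun p : ℝ × ℝ => F a (p.1 ^ 2 + p.2 ^ 2))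
  refine (Eq.trans ?_ h1).trans ((Eq.trans ?_ h2).trans ?_)
  · rfl
  · rfl
  · rw [Measure.volume_eq_prod, lintegral_prod]
    · refine lintegral_congr fun a => ?_
      rw [← h3 a]
      rfl
    · apply Measurable.aemeasurable
      exact hF' _ _ (by fun_prop) (by fun_prop)

lemma aux_main (F : ℝ → ℝ → ENNReal) (hF : Measurable (Function.uncurry F)) :
    ∫⁻ y : EuclideanSpace ℝ (Fin 3), F (y 0) (y 1 ^ 2 + y 2 ^ 2) =
      ENNReal.ofReal (2 * Real.pi) * ∫⁻ s in Set.Ioi (0:ℝ),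
        ∫⁻ θ in Set.Ioo (-Real.pi) Real.pi,
          ENNReal.ofReal s * (ENNReal.ofReal (s * Real.sin θ) *
            F (s * Real.cos θ) ((s * Real.sin θ) ^ 2)) := by
  have hF' : ∀ {α : Type} [MeasurableSpace α] (u v : α → ℝ), Measurable u → Measurable v →
      Measurable (fun t => F (u t) (v t)) := fun u v hu hv => hF.comp (hu.prodMk hv)
  have hm : Measurable (fun p : ℝ × ℝ => ENNReal.ofReal p.2 * F p.1 (p.2 ^ 2)) := by
    have := hF' (fun p : ℝ × ℝ => p.1) (fun p => p.2 ^ 2) (by fun_prop) (by fun_prop)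
    fun_prop
  rw [aux_cyl F hF]
  have h1 : ∀ a : ℝ, ∫⁻ p : ℝ × ℝ, F a (p.1 ^ 2 + p.2 ^ 2) =
      ENNReal.ofReal (2 * Real.pi) * ∫⁻ ρ : ℝ, ENNReal.ofReal ρ * F a (ρ ^ 2) := by
    intro a
    rw [aux_polar _ (hF' _ _ (by fun_prop) (by fun_prop))]
    have : ∀ s θ : ℝ, (s * Real.cos θ) ^ 2 + (s * Real.sin θ) ^ 2 = s ^ 2 := by
      intro s θ
      linear_combination s ^ 2 * Real.sin_sq_add_cos_sq θ
    simp only [this, lintegral_const, Measure.restrict_apply MeasurableSet.univ, Set.univ_inter,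
      Real.volume_Ioo]
    rw [lintegral_mul_const _ (by
      have := hF' (fun _ : ℝ => a) (fun ρ => ρ ^ 2) (by fun_prop) (by fun_prop)
      fun_prop), mul_comm]
    congr 1
    · congr 1; ring
    · rw [← lintegral_indicator measurableSet_Ioi]
      refine lintegral_congr fun ρ => ?_
      by_cases h : 0 < ρ
      · simp [h]
      · simp [h, ENNReal.ofReal_of_nonpos (not_lt.mp h)]
  simp only [h1]
  rw [lintegral_const_mul _ (Measurable.lintegral_prod_right hm), ← aux_polar
    (fun p : ℝ × ℝ => ENNReal.ofReal p.2 * F p.1 (p.2 ^ 2)) hm, Measure.volume_eq_prod,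
    lintegral_prod _ hm.aemeasurable]

lemma aux_sin (h : ℝ → ℝ) (hc : Continuous h) (h0 : ∀ t, 0 ≤ h t) :
    ∫⁻ θ in Set.Ioo (-Real.pi) Real.pi, ENNReal.ofReal (Real.sin θ) * ENNReal.ofReal (h θ) =
      ENNReal.ofReal (∫ θ in (0:ℝ)..Real.pi, Real.sin θ * h θ) := by
  have hpi := Real.pi_pos
  rw [intervalIntegral.integral_of_le hpi.le, integral_Ioc_eq_integral_Ioo,
    ofReal_integral_eq_lintegral_ofReal]
  · rw [← lintegral_indicator measurableSet_Ioo, ← lintegral_indicator measurableSet_Ioo]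
    refine lintegral_congr fun θ => ?_
    simp only [← ENNReal.ofReal_mul' (h0 _)]
    by_cases h1 : θ ∈ Set.Ioo 0 Real.pi
    · rw [Set.indicator_of_mem h1, Set.indicator_of_mem
        (show θ ∈ Set.Ioo (-Real.pi) Real.pi from ⟨by linarith [h1.1], h1.2⟩)]
    · rw [Set.indicator_of_notMem h1]
      by_cases h2 : θ ∈ Set.Ioo (-Real.pi) Real.pi
      · rw [Set.indicator_of_mem h2]
        apply ENNReal.ofReal_of_nonpos
        have h3 : θ ≤ 0 := by
          by_contra h4
          exact h1 ⟨not_le.mp h4, h2.2⟩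
        exact mul_nonpos_of_nonpos_of_nonneg
          (Real.sin_nonpos_of_nonpos_of_neg_pi_le h3 h2.1.le) (h0 θ)
      · rw [Set.indicator_of_notMem h2]
  · exact ((Real.continuous_sin.mul hc).integrableOn_Icc).mono_set Set.Ioo_subset_Icc_self
  · refine (ae_restrict_iff' measurableSet_Ioo).2 (Filter.Eventually.of_forall fun θ hθ => ?_)
    exact mul_nonneg (Real.sin_nonneg_of_nonneg_of_le_pi hθ.1.le hθ.2.le) (h0 θ)

lemma aux_pos {R s : ℝ} (hs : 0 < s) (hR : s < R) (t : ℝ) :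
    0 < R ^ 2 + s ^ 2 - 2 * R * s * Real.cos t := by
  nlinarith [Real.cos_le_one t, mul_pos hs (hs.trans hR), sq_pos_of_pos (sub_pos.2 hR)]

lemma aux_int {R s : ℝ} (hs : 0 < s) (hR : s < R) :
    ∫ θ in (0:ℝ)..Real.pi, Real.sin θ * (1 / √(R ^ 2 + s ^ 2 - 2 * R * s * Real.cos θ)) =
      2 / R := by
  have hR0 : 0 < R := hs.trans hR
  have hp := aux_pos hs hR
  rw [intervalIntegral.integral_eq_sub_of_hasDerivAt
    (f := fun θ => √(R ^ 2 + s ^ 2 - 2 * R * s * Real.cos θ) / (R * s))]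
  · have e1 : R ^ 2 + s ^ 2 - 2 * R * s * Real.cos Real.pi = (R + s) ^ 2 := by
      rw [Real.cos_pi]; ring
    have e2 : R ^ 2 + s ^ 2 - 2 * R * s * Real.cos 0 = (R - s) ^ 2 := by
      rw [Real.cos_zero]; ring
    simp only [e1, e2]
    rw [Real.sqrt_sq (by linarith), Real.sqrt_sq (by linarith)]
    field_simp
    ring
  · intro θ _
    have h1 : HasDerivAt (fun θ => R ^ 2 + s ^ 2 - 2 * R * s * Real.cos θ)
        (2 * R * s * Real.sin θ) θ := by
      have := ((Real.hasDerivAt_cos θ).const_mul (2 * R * s)).const_sub (R ^ 2 + s ^ 2)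
      exact this.congr_deriv (by ring)
    refine ((h1.sqrt (hp θ).ne').div_const (R * s)).congr_deriv ?_
    have := (Real.sqrt_pos.2 (hp θ)).ne'
    field_simp
  · apply Continuous.intervalIntegrable
    refine Real.continuous_sin.mul (continuous_const.div (by fun_prop) fun t => ?_)
    exact (Real.sqrt_pos.2 (hp t)).ne'

lemma aux_norm (y : EuclideanSpace ℝ (Fin 3)) : ‖y‖ = √(y 0 ^ 2 + (y 1 ^ 2 + y 2 ^ 2)) := by
  rw [EuclideanSpace.norm_eq, Fin.sum_univ_three]
  simp [add_assoc]

lemma aux_radial (g : ℝ → ℝ) (hg : Measurable g) (hg0 : ∀ s, 0 ≤ g s) (R : ℝ) (hR : 0 < R)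
    (hv : ∀ s, R < s → g s = 0) :
    ∫⁻ y : EuclideanSpace ℝ (Fin 3),
      ENNReal.ofReal (g ‖y‖ / ‖EuclideanSpace.single (0 : Fin 3) R - y‖) =
    ENNReal.ofReal (1 / R) * ∫⁻ y : EuclideanSpace ℝ (Fin 3), ENNReal.ofReal (g ‖y‖) := by
  have e1 : ∀ y : EuclideanSpace ℝ (Fin 3), ‖EuclideanSpace.single (0 : Fin 3) R - y‖ =
      √((R - y 0) ^ 2 + (y 1 ^ 2 + y 2 ^ 2)) := by
    intro y
    rw [aux_norm]
    simp
  simp only [e1, aux_norm]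
  have hA := aux_main (fun a b => ENNReal.ofReal (g √(a ^ 2 + b) / √((R - a) ^ 2 + b)))
    (by unfold Function.uncurry; fun_prop)
  have hB := aux_main (fun a b => ENNReal.ofReal (g √(a ^ 2 + b)))
    (by unfold Function.uncurry; fun_prop)
  refine hA.trans (Eq.trans ?_ (congrArg _ hB).symm)
  rw [mul_left_comm]
  congr 1
  rw [← lintegral_const_mul' _ _ ENNReal.ofReal_ne_top]
  refine lintegral_congr_ae ?_
  have hne : ∀ᵐ s : ℝ ∂(volume.restrict (Set.Ioi 0)), s ≠ R :=
    ae_restrict_of_ae (Measure.ae_ne volume R)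
  filter_upwards [hne, ae_restrict_mem measurableSet_Ioi] with s hs hs0
  have hs0 : 0 < s := hs0
  have q1 : ∀ θ, √((s * Real.cos θ) ^ 2 + (s * Real.sin θ) ^ 2) = s := by
    intro θ
    rw [show (s * Real.cos θ) ^ 2 + (s * Real.sin θ) ^ 2 = s ^ 2 by
      linear_combination s ^ 2 * Real.sin_sq_add_cos_sq θ, Real.sqrt_sq hs0.le]
  have q2 : ∀ θ, (R - s * Real.cos θ) ^ 2 + (s * Real.sin θ) ^ 2 =
      R ^ 2 + s ^ 2 - 2 * R * s * Real.cos θ := by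
    intro θ
    linear_combination s ^ 2 * Real.sin_sq_add_cos_sq θ
  simp only [q1, q2]
  rcases lt_or_gt_of_ne hs with hlt | hgt
  · have hp := aux_pos hs0 hlt
    have hA : ∀ θ, ENNReal.ofReal s * (ENNReal.ofReal (s * Real.sin θ) *
        ENNReal.ofReal (g s / √(R ^ 2 + s ^ 2 - 2 * R * s * Real.cos θ))) =
        ENNReal.ofReal s * ENNReal.ofReal s * ENNReal.ofReal (g s) *
        (ENNReal.ofReal (Real.sin θ) *
          ENNReal.ofReal (1 / √(R ^ 2 + s ^ 2 - 2 * R * s * Real.cos θ))) := by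
      intro θ
      rw [ENNReal.ofReal_mul hs0.le, div_eq_mul_one_div, ENNReal.ofReal_mul (hg0 s)]
      ring
    have hB : ∀ θ, ENNReal.ofReal s * (ENNReal.ofReal (s * Real.sin θ) *
        ENNReal.ofReal (g s)) =
        ENNReal.ofReal s * ENNReal.ofReal s * ENNReal.ofReal (g s) *
        (ENNReal.ofReal (Real.sin θ) * ENNReal.ofReal 1) := by
      intro θ
      rw [ENNReal.ofReal_mul hs0.le, ENNReal.ofReal_one]
      ring
    simp only [hA, hB]
    have hfin : ENNReal.ofReal s * ENNReal.ofReal s * ENNReal.ofReal (g s) ≠ ⊤ := by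
      finiteness
    rw [lintegral_const_mul' _ _ hfin, lintegral_const_mul' _ _ hfin,
      aux_sin (fun θ => 1 / √(R ^ 2 + s ^ 2 - 2 * R * s * Real.cos θ))
        (continuous_const.div (by fun_prop) fun t => (Real.sqrt_pos.2 (hp t)).ne')
        (fun t => by positivity),
      aux_sin (fun _ => 1) continuous_const (fun _ => zero_le_one), aux_int hs0 hlt, mul_left_comm]
    congr 1
    rw [← ENNReal.ofReal_mul (by positivity)]
    congr 1
    simp
    ring
  · simp [hv s hgt]

/-- Newton's theorem for smoothed point masses.  If `lam` is an
`r`-smoothing of the point mass `(x₀, m)`, then at every point `x` with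
`‖x - x₀‖ ≥ r` the Newtonian potential of `lam` equals `m / ‖x - x₀‖`. -/
theorem newton_theorem_smoothed_point_mass
    (r m : ℝ) (hr : 0 < r) (hm : 0 < m)
    (x₀ : EuclideanSpace ℝ (Fin 3)) (lam : EuclideanSpace ℝ (Fin 3) → ℝ)
    (hlam : IsSmoothing r m x₀ lam) :
    ∀ x : EuclideanSpace ℝ (Fin 3), r ≤ ‖x - x₀‖ →
      newtonPotential lam x = m / ‖x - x₀‖ := by
  intro x hx
  obtain ⟨hc, h0, hrad, hsupp, hint⟩ := hlam
  set R := ‖x - x₀‖ with hRdef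
  have hR : 0 < R := hr.trans_le hx
  set e : EuclideanSpace ℝ (Fin 3) := EuclideanSpace.single (0 : Fin 3) R with he
  have hen : ‖e‖ = ‖x - x₀‖ := by simp [he, ← hRdef, abs_of_pos hR]
  obtain ⟨L, hL⟩ : ∃ L : EuclideanSpace ℝ (Fin 3) ≃ₗᵢ[ℝ] EuclideanSpace ℝ (Fin 3),
      L e = x - x₀ := ⟨_, Submodule.reflection_sub hen⟩
  set g : ℝ → ℝ := fun s => lam (x₀ + EuclideanSpace.single (0 : Fin 3) s) with hg
  have hgm : Continuous g := by
    have : Continuous fun s : ℝ => EuclideanSpace.single (0 : Fin 3) s :=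
      (LinearIsometry.continuous (E := ℝ) (E₂ := EuclideanSpace ℝ (Fin 3)) (σ₁₂ := RingHom.id ℝ)
        ⟨(EuclideanSpace.basisFun (Fin 3) ℝ 0 |> LinearMap.toSpanSingleton ℝ _), by
          intro s; simp [norm_smul]⟩).congr (by
            intro s; ext i; simp [Pi.single_apply])
    fun_prop
  have hgL : ∀ y, lam (x₀ + L y) = g ‖y‖ := by
    intro y
    apply hrad
    simp
  have hv : ∀ s, R < s → g s = 0 := by
    intro s hs
    apply image_eq_zero_of_notMem_tsupport (f := lam)
    rw [hsupp]
    simp only [mem_closedBall, dist_self_add_left, not_le]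
    have : ‖EuclideanSpace.single (0 : Fin 3) s‖ = s := by
      simp [abs_of_pos (hR.trans hs)]
    rw [this]
    linarith
  have hcov : ∀ f : EuclideanSpace ℝ (Fin 3) → ENNReal,
      ∫⁻ y, f y = ∫⁻ y, f (x₀ + L y) := by
    intro f
    rw [← lintegral_add_left_eq_self f x₀]
    exact (L.measurePreserving.lintegral_comp_emb L.toMeasurableEquiv.measurableEmbedding
      (fun y => f (x₀ + y))).symm
  have key := aux_radial g hgm.measurable (fun s => h0 _) R hR hv
  unfold newtonPotential
  rw [integral_eq_lintegral_of_nonneg_ae (Filter.Eventually.of_forall fun y =>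
    div_nonneg (h0 y) (norm_nonneg _)) (by
      apply Measurable.aestronglyMeasurable
      exact hc.measurable.div (by fun_prop)), hcov]
  rw [integral_eq_lintegral_of_nonneg_ae (Filter.Eventually.of_forall h0)
    hc.aestronglyMeasurable, hcov] at hint
  have hn : ∀ y, ‖x - (x₀ + L y)‖ = ‖e - y‖ := by
    intro y
    rw [← sub_sub, ← hL, ← map_sub, L.norm_map]
  simp only [hgL, hn] at hint ⊢
  rw [key, ENNReal.toReal_mul, hint, ENNReal.toReal_ofReal (by positivity)]
  ring
end

section
/- Let k ≥ 1 and for each i = 1, …, k let λᵢ be an rᵢ-smoothing of a point mass (xᵢ, mᵢ), and set λ = λ₁ + ⋯ + λ_k. Then for every x ∈ ℝ³ satisfying ‖x − xᵢ‖ ≥ rᵢ for all i, the Newtonian potential satisfies V_λ(x) = Σ_{i=1}^{k} mᵢ/‖x − xᵢ‖; i.e., outside all of the balls B̄_{rᵢ}(xᵢ) the potential of the smoothed point-mass array λ equals that of the finite array of point masses {(xᵢ, mᵢ)}. -/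
open MeasureTheory Metric

open scoped ENNReal

local notation "E3" => EuclideanSpace ℝ (Fin 3)

lemma polar2 (f : ℝ × ℝ → ℝ≥0∞) (hf : Measurable f) :
    ∫⁻ p, f p = ∫⁻ s in Set.Ioi (0:ℝ), ∫⁻ θ in Set.Ioo (-Real.pi) Real.pi,
      ENNReal.ofReal s * f (s * Real.cos θ, s * Real.sin θ) := by
  rw [← lintegral_comp_polarCoord_symm, polarCoord_target, Measure.volume_eq_prod,
    setLIntegral_prod]
  · simp [polarCoord_symm_apply]
  · have := continuous_polarCoord_symm.measurable
    have h1 : Measurable fun p : ℝ × ℝ => ENNReal.ofReal p.1 := by fun_prop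
    exact (h1.smul (hf.comp this)).aemeasurable

lemma toProd (F : ℝ → ℝ → ℝ → ℝ≥0∞) (hF : Measurable fun q : ℝ × ℝ × ℝ => F q.1 q.2.1 q.2.2) :
    ∫⁻ y : E3, F (y 0) (y 1) (y 2) = ∫⁻ z, ∫⁻ p : ℝ × ℝ, F z p.1 p.2 := by
  have h1 := (PiLp.volume_preserving_ofLp (Fin 3)).lintegral_comp_emb
    (MeasurableEquiv.toLp 2 (Fin 3 → ℝ)).symm.measurableEmbedding
    (fun y : Fin 3 → ℝ => F (y 0) (y 1) (y 2))
  have h2 := (volume_preserving_piFinSuccAbove (fun _ : Fin 3 => ℝ) 0).lintegral_comp_emb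
    (MeasurableEquiv.measurableEmbedding _)
    (fun y : ℝ × (Fin 2 → ℝ) => F (y.1) (y.2 0) (y.2 1))
  refine h1.trans (Eq.trans ?_ (h2.trans ?_))
  · rfl
  · rw [Measure.volume_eq_prod, lintegral_prod]
    · refine lintegral_congr fun z => ?_
      exact (volume_preserving_finTwoArrow ℝ).lintegral_comp_emb
        (MeasurableEquiv.measurableEmbedding _) (fun y : ℝ × ℝ => F z y.1 y.2)
    · refine Measurable.aemeasurable ?_
      exact hF.comp (g := fun q : ℝ × ℝ × ℝ => F q.1 q.2.1 q.2.2)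
        (f := fun y : ℝ × (Fin 2 → ℝ) => (y.1, y.2 0, y.2 1)) (by fun_prop)

lemma sph (Φ : ℝ → ℝ → ℝ≥0∞) (hΦ : Measurable fun q : ℝ × ℝ => Φ q.1 q.2) :
    ∫⁻ y : E3, Φ (y 0) ((y 1)^2 + (y 2)^2) = ENNReal.ofReal (2 * Real.pi) *
      ∫⁻ s in Set.Ioi (0:ℝ), ∫⁻ θ in Set.Ioo 0 Real.pi,
        ENNReal.ofReal (s^2 * Real.sin θ) * Φ (s * Real.cos θ) ((s * Real.sin θ)^2) := by
  have m1 : Measurable fun q : ℝ × ℝ × ℝ => Φ q.1 (q.2.1^2 + q.2.2^2) :=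
    hΦ.comp (g := fun q : ℝ × ℝ => Φ q.1 q.2)
      (f := fun q : ℝ × ℝ × ℝ => (q.1, q.2.1^2+q.2.2^2)) (by fun_prop)
  have m2 : Measurable fun q : ℝ × ℝ => Φ q.1 (q.2^2) :=
    hΦ.comp (g := fun q : ℝ × ℝ => Φ q.1 q.2) (f := fun q : ℝ × ℝ => (q.1, q.2^2)) (by fun_prop)
  have m3 : Measurable fun q : ℝ × ℝ => ENNReal.ofReal q.2 * Φ q.1 (q.2^2) :=
    Measurable.mul (by fun_prop) m2
  rw [toProd (fun z a b => Φ z (a^2+b^2)) m1]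
  have step1 : ∀ z, ∫⁻ p : ℝ × ℝ, Φ z (p.1^2+p.2^2) =
      ENNReal.ofReal (2 * Real.pi) * ∫⁻ ρ, ENNReal.ofReal ρ * Φ z (ρ^2) := by
    intro z
    rw [polar2 (fun p => Φ z (p.1^2+p.2^2)) (m1.comp (f := fun p : ℝ × ℝ => (z, p)) (by fun_prop))]
    have e : ∀ s θ : ℝ, (s * Real.cos θ)^2 + (s * Real.sin θ)^2 = s^2 := by
      intro s θ
      linear_combination s^2 * Real.sin_sq_add_cos_sq θ
    simp only [e, lintegral_const, Measure.restrict_apply_univ, Real.volume_Ioo]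
    rw [lintegral_mul_const'' _ (by
      exact (m3.comp (f := fun p : ℝ => (z, p)) (by fun_prop)).aemeasurable), mul_comm]
    congr 1
    · congr 1; ring
    · rw [← lintegral_indicator measurableSet_Ioi]
      refine lintegral_congr fun s => ?_
      by_cases hs : 0 < s
      · simp [hs]
      · simp [hs, ENNReal.ofReal_of_nonpos (not_lt.1 hs)]
  simp only [step1]
  have m3' : ∀ z, Measurable fun ρ => ENNReal.ofReal ρ * Φ z (ρ^2) := fun z =>
    m3.comp (f := fun p : ℝ => (z, p)) (by fun_prop)
  rw [lintegral_const_mul _ m3.lintegral_prod_right']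
  congr 1
  rw [← lintegral_prod (fun q : ℝ × ℝ => ENNReal.ofReal q.2 * Φ q.1 (q.2^2)) m3.aemeasurable,
    ← Measure.volume_eq_prod, polar2 _ m3]
  refine setLIntegral_congr_fun measurableSet_Ioi fun s hs => ?_
  have hs : 0 < s := hs
  rw [← lintegral_indicator measurableSet_Ioo, ← lintegral_indicator measurableSet_Ioo]
  refine lintegral_congr fun θ => ?_
  by_cases h0 : 0 < θ
  · have : (-Real.pi < θ) := by linarith [Real.pi_pos]
    by_cases h1 : θ < Real.pi
    · simp only [Set.indicator, Set.mem_Ioo, h0, h1, this, and_self, if_true]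
      rw [← mul_assoc, ← ENNReal.ofReal_mul hs.le]
      congr 2; ring
    · simp [h1]
  · by_cases h1 : -Real.pi < θ
    · have : s * Real.sin θ ≤ 0 := mul_nonpos_of_nonneg_of_nonpos hs.le
        (Real.sin_nonpos_of_nonpos_of_neg_pi_le (not_lt.1 h0) h1.le)
      simp [h0, ENNReal.ofReal_of_nonpos this]
    · simp [h0, h1]

lemma ang0 : ∫⁻ θ in Set.Ioo 0 Real.pi, ENNReal.ofReal (Real.sin θ) = ENNReal.ofReal 2 := by
  have : ∫ θ in (0:ℝ)..Real.pi, Real.sin θ = 2 := by simp; norm_num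
  rw [← this, intervalIntegral.integral_of_le Real.pi_pos.le, integral_Ioc_eq_integral_Ioo,
    ofReal_integral_eq_lintegral_ofReal]
  · exact (Real.continuous_sin.integrableOn_Icc (a := 0) (b := Real.pi)).mono_set
      Set.Ioo_subset_Icc_self
  · filter_upwards [ae_restrict_mem measurableSet_Ioo] with θ hθ
    exact Real.sin_nonneg_of_mem_Icc ⟨hθ.1.le, hθ.2.le⟩

lemma ang1 (s R : ℝ) (hs : 0 < s) (hR : s < R) :
    ∫⁻ θ in Set.Ioo 0 Real.pi,
      ENNReal.ofReal (Real.sin θ * (1 / √((R - s * Real.cos θ)^2 + (s * Real.sin θ)^2)))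
      = ENNReal.ofReal (2 / R) := by
  have hpos : ∀ θ : ℝ, 0 < (R - s * Real.cos θ)^2 + (s * Real.sin θ)^2 := by
    intro θ
    have : s * Real.cos θ ≤ s := by nlinarith [Real.cos_le_one θ]
    have : 0 < R - s * Real.cos θ := by linarith
    positivity
  have hcont : Continuous fun θ : ℝ =>
      Real.sin θ * (1 / √((R - s * Real.cos θ)^2 + (s * Real.sin θ)^2)) := by
    refine Continuous.mul (by fun_prop) (Continuous.div (by fun_prop) (by fun_prop) ?_)
    intro θ
    exact (Real.sqrt_pos.2 (hpos θ)).ne'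
  have hR0 : 0 < R := hs.trans hR
  have : ∫ θ in (0:ℝ)..Real.pi,
      Real.sin θ * (1 / √((R - s * Real.cos θ)^2 + (s * Real.sin θ)^2)) = 2 / R := by
    rw [intervalIntegral.integral_eq_sub_of_hasDerivAt
      (f := fun θ => √((R - s * Real.cos θ)^2 + (s * Real.sin θ)^2) / (s * R))
      (fun θ _ => ?_) (hcont.intervalIntegrable _ _)]
    · have e1 : (R - s * Real.cos Real.pi)^2 + (s * Real.sin Real.pi)^2 = (R + s)^2 := by
        simp
      have e2 : (R - s * Real.cos 0)^2 + (s * Real.sin 0)^2 = (R - s)^2 := by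
        simp
      simp only [e1, e2]
      rw [Real.sqrt_sq (by linarith), Real.sqrt_sq (by linarith)]
      field_simp
      ring
    · have h1 : HasDerivAt (fun θ => (R - s * Real.cos θ)^2 + (s * Real.sin θ)^2)
          (2 * (s * R) * Real.sin θ) θ := by
        have := (((((Real.hasDerivAt_cos θ).const_mul s).const_sub R).pow 2).add
          (((Real.hasDerivAt_sin θ).const_mul s).pow 2))
        refine this.congr_deriv ?_
        norm_num
        ring
      refine ((h1.sqrt (hpos θ).ne').div_const (s * R)).congr_deriv ?_
      have := (Real.sqrt_pos.2 (hpos θ)).ne'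
      field_simp
  rw [← this, intervalIntegral.integral_of_le Real.pi_pos.le, integral_Ioc_eq_integral_Ioo,
    ofReal_integral_eq_lintegral_ofReal]
  · exact (hcont.integrableOn_Icc (a := 0) (b := Real.pi)).mono_set
      Set.Ioo_subset_Icc_self
  · filter_upwards [ae_restrict_mem measurableSet_Ioo] with θ hθ
    have := Real.sin_nonneg_of_mem_Icc ⟨hθ.1.le, hθ.2.le⟩
    simp only [Pi.zero_apply]
    positivity

lemma norm3 (y : E3) : ‖y‖ = √((y 0)^2 + ((y 1)^2 + (y 2)^2)) := by
  rw [EuclideanSpace.norm_eq, Fin.sum_univ_three]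
  simp [add_assoc]

lemma radial_mass (G : ℝ → ℝ≥0∞) (hG : Measurable G) :
    ∫⁻ y : E3, G ‖y‖ = ENNReal.ofReal (2 * Real.pi) *
      ∫⁻ s in Set.Ioi (0:ℝ), ENNReal.ofReal (s^2) * G s * ENNReal.ofReal 2 := by
  simp only [norm3]
  rw [sph (fun z q => G √(z^2 + q)) (by fun_prop)]
  congr 1
  refine setLIntegral_congr_fun measurableSet_Ioi fun s hs => ?_
  have hs : 0 < s := hs
  have e : ∀ θ : ℝ, √((s * Real.cos θ)^2 + (s * Real.sin θ)^2) = s := by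
    intro θ
    rw [show (s * Real.cos θ)^2 + (s * Real.sin θ)^2 = s^2 by
      linear_combination s^2 * Real.sin_sq_add_cos_sq θ, Real.sqrt_sq hs.le]
  simp only [e]
  rw [← ang0, ← lintegral_const_mul _ (by fun_prop)]
  refine lintegral_congr fun θ => ?_
  rw [ENNReal.ofReal_mul (by positivity)]
  ring

lemma radial_pot (G : ℝ → ℝ≥0∞) (hG : Measurable G) (R : ℝ) (hR : 0 < R)
    (hGR : ∀ s, R < s → G s = 0) :
    ∫⁻ y : E3, G ‖y‖ * ENNReal.ofReal (1 / ‖EuclideanSpace.single 0 R - y‖)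
      = ENNReal.ofReal (1 / R) * ∫⁻ y : E3, G ‖y‖ := by
  have n2 : ∀ y : E3, ‖EuclideanSpace.single 0 R - y‖ = √((R - y 0)^2 + ((y 1)^2 + (y 2)^2)) := by
    intro y
    rw [norm3]; simp
  rw [radial_mass G hG]
  simp only [n2]
  simp only [norm3]
  rw [sph (fun z q => G √(z^2 + q) * ENNReal.ofReal (1 / √((R - z)^2 + q))) (by fun_prop),
    mul_left_comm]
  congr 1
  rw [← lintegral_const_mul _ (by fun_prop)]
  have hne : ∀ᵐ s : ℝ ∂(volume.restrict (Set.Ioi 0)), s ≠ R :=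
    ae_restrict_of_ae (by simp [ae_iff])
  refine lintegral_congr_ae ?_
  filter_upwards [hne, ae_restrict_mem measurableSet_Ioi] with s hsR hs
  have hs : 0 < s := hs
  have e : ∀ θ : ℝ, √((s * Real.cos θ)^2 + (s * Real.sin θ)^2) = s := by
    intro θ
    rw [show (s * Real.cos θ)^2 + (s * Real.sin θ)^2 = s^2 by
      linear_combination s^2 * Real.sin_sq_add_cos_sq θ, Real.sqrt_sq hs.le]
  simp only [e]
  rcases lt_or_gt_of_ne hsR with h | h
  · have h2 : ENNReal.ofReal (1 / R) * (ENNReal.ofReal (s^2) * G s * ENNReal.ofReal 2)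
      = (ENNReal.ofReal (s^2) * G s) * ENNReal.ofReal (2 / R) := by
      rw [show 2 / R = (1 / R) * 2 by ring, ENNReal.ofReal_mul (by positivity)]
      ring
    rw [h2, ← ang1 s R hs h, ← lintegral_const_mul _ (by fun_prop)]
    refine lintegral_congr fun θ => ?_
    rw [ENNReal.ofReal_mul (by positivity), ENNReal.ofReal_mul' (by positivity)]
    ring
  · simp [hGR s h]

lemma smoothing_pot (r m : ℝ) (x₀ : E3) (lam : E3 → ℝ) (hr : 0 < r)
    (h : IsSmoothing r m x₀ lam) (p : E3) (hp : r ≤ ‖p - x₀‖) :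
    Integrable (fun y => lam y / ‖p - y‖) ∧ ∫ y, lam y / ‖p - y‖ = m / ‖p - x₀‖ := by
  obtain ⟨hc, hnn, hrad, hsupp, hint⟩ := h
  set R := ‖p - x₀‖ with hRdef
  have hR : 0 < R := hr.trans_le hp
  have hcs : HasCompactSupport lam := by
    rw [HasCompactSupport, hsupp]; exact isCompact_closedBall _ _
  have hli : Integrable lam := hc.integrable_of_hasCompactSupport hcs
  let G : ℝ → ℝ≥0∞ := fun s => ENNReal.ofReal (lam (x₀ + EuclideanSpace.single 0 s))
  have hsing : Continuous fun s : ℝ => (EuclideanSpace.single 0 s : E3) := by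
    have : (fun s : ℝ => (EuclideanSpace.single 0 s : E3)) =
        fun s => s • (EuclideanSpace.single 0 (1:ℝ) : E3) := by
      ext s i; simp
    rw [this]; fun_prop
  have hG : Measurable G := by
    have : Continuous fun s : ℝ => lam (x₀ + EuclideanSpace.single 0 s) := by fun_prop
    fun_prop
  have hlamG : ∀ y, ENNReal.ofReal (lam (y + x₀)) = G ‖y‖ := by
    intro y
    simp only [G]
    congr 1
    apply hrad
    simp
  have hGR : ∀ s, R < s → G s = 0 := by
    intro s hs
    have : lam (x₀ + EuclideanSpace.single 0 s) = 0 := by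
      apply image_eq_zero_of_notMem_tsupport
      rw [hsupp]
      simp only [mem_closedBall, dist_eq_norm, add_sub_cancel_left, EuclideanSpace.norm_single,
        Real.norm_eq_abs, not_le]
      exact lt_of_lt_of_le (hp.trans_lt hs) (le_abs_self s)
    simp [G, this]
  have hmeas : Measurable fun y => lam y / ‖p - y‖ := by
    have := hc.measurable
    fun_prop
  have hnn' : ∀ y, 0 ≤ lam y / ‖p - y‖ := fun y => div_nonneg (hnn y) (norm_nonneg _)
  have hm : ENNReal.ofReal m = ∫⁻ y : E3, G ‖y‖ := by
    rw [← hint, ofReal_integral_eq_lintegral_ofReal hli (.of_forall hnn),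
      ← lintegral_add_right_eq_self _ x₀]
    simp only [hlamG]
  have hm0 : 0 ≤ m := hint ▸ integral_nonneg hnn
  have hn : ‖p - x₀‖ = ‖(EuclideanSpace.single 0 R : E3)‖ := by
    simp [abs_of_pos hR, hRdef]
  let T : E3 ≃ₗᵢ[ℝ] E3 := (ℝ ∙ ((p - x₀) - EuclideanSpace.single 0 R))ᗮ.reflection
  have hT : T (p - x₀) = EuclideanSpace.single 0 R := Submodule.reflection_sub hn
  have key : ∫⁻ y, ENNReal.ofReal (lam y / ‖p - y‖) = ENNReal.ofReal (m / R) := by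
    rw [← lintegral_add_right_eq_self _ x₀]
    rw [show m / R = 1 / R * m by ring, ENNReal.ofReal_mul (by positivity), hm,
      ← radial_pot G hG R hR hGR]
    rw [← T.measurePreserving.lintegral_comp_emb T.toMeasurableEquiv.measurableEmbedding
      (fun y => G ‖y‖ * ENNReal.ofReal (1 / ‖EuclideanSpace.single 0 R - y‖))]
    refine lintegral_congr fun y => ?_
    rw [← hT, ← map_sub, T.norm_map, T.norm_map, ← hlamG, ← ENNReal.ofReal_mul (hnn _)]
    congr 1
    rw [show p - (y + x₀) = p - x₀ - y by abel]
    ring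
  constructor
  · refine ⟨hmeas.aestronglyMeasurable, ?_⟩
    rw [hasFiniteIntegral_iff_ofReal (.of_forall hnn'), key]
    exact ENNReal.ofReal_lt_top
  · rw [integral_eq_lintegral_of_nonneg_ae (.of_forall hnn') hmeas.aestronglyMeasurable, key,
      ENNReal.toReal_ofReal (by positivity)]

/-- The Newtonian potential of a smoothed point-mass array
`λ = λ₁ + ⋯ + λ_k` agrees, outside all the balls `B̄_{rᵢ}(xᵢ)`, with the potential
`Σᵢ mᵢ / ‖x - xᵢ‖` of the corresponding finite array of point masses. -/
theorem newton_theorem_SPMA (k : ℕ) (hk : 1 ≤ k)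
    (x : Fin k → EuclideanSpace ℝ (Fin 3)) (r m : Fin k → ℝ)
    (hr : ∀ i, 0 < r i) (hm : ∀ i, 0 < m i)
    (lam : Fin k → EuclideanSpace ℝ (Fin 3) → ℝ)
    (hlam : ∀ i, IsSmoothing (r i) (m i) (x i) (lam i)) :
    ∀ p : EuclideanSpace ℝ (Fin 3), (∀ i, r i ≤ ‖p - x i‖) →
      newtonPotential (fun y => ∑ i, lam i y) p = ∑ i, m i / ‖p - x i‖ := by
  intro p hp
  have H := fun i => smoothing_pot (r i) (m i) (x i) (lam i) (hr i) (hlam i) p (hp i)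
  unfold newtonPotential
  simp only [Finset.sum_div]
  rw [integral_finsetSum _ (fun i _ => (H i).1)]
  exact Finset.sum_congr rfl fun i _ => (H i).2
end

section
/- (Spherical filling.) Let f : ℝ³ → ℝ be continuous and nonnegative with compact support K, and let ε > 0. Then there exist finitely many closed balls B̄_{r₁}(y₁), …, B̄_{r_M}(y_M), each contained in K and with pairwise disjoint interiors, such that ∫_{K ∖ (B̄_{r₁}(y₁) ∪ ⋯ ∪ B̄_{r_M}(y_M))} f(x) dx < ε and var(f, B̄_{rᵢ}(yᵢ)) < ε for every i. -/
open MeasureTheory Metric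

/-- `var f K`: the infimum of `b - a` over intervals `[a, b]` containing `f(K)`. -/
noncomputable def var (f : EuclideanSpace ℝ (Fin 3) → ℝ)
    (K : Set (EuclideanSpace ℝ (Fin 3))) : ℝ :=
  sInf {d : ℝ | ∃ a b : ℝ, d = b - a ∧ f '' K ⊆ Set.Icc a b}

/-- Spherical filling.  A continuous nonnegative `f` with compact
support `K` admits, for every `ε > 0`, a finite family of closed balls contained in `K`
with pairwise disjoint interiors, capturing all but `ε` of the total mass, and such that
the variation of `f` on each ball is `< ε`. -/
theorem spherical_filling (f : EuclideanSpace ℝ (Fin 3) → ℝ)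
    (hf : Continuous f) (hf0 : ∀ y, 0 ≤ f y)
    (K : Set (EuclideanSpace ℝ (Fin 3))) (hK : K = tsupport f) (hKc : IsCompact K)
    (ε : ℝ) (hε : 0 < ε) :
    ∃ (M : ℕ) (y : Fin M → EuclideanSpace ℝ (Fin 3)) (r : Fin M → ℝ),
      (∀ i, 0 < r i) ∧
      (∀ i, closedBall (y i) (r i) ⊆ K) ∧
      (∀ i j, i ≠ j →
        Disjoint (interior (closedBall (y i) (r i))) (interior (closedBall (y j) (r j)))) ∧
      (∫ p in K \ ⋃ i, closedBall (y i) (r i), f p) < ε ∧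
      (∀ i, var f (closedBall (y i) (r i)) < ε) := by
  classical
  have hsK : Function.support f ⊆ K := hK ▸ subset_tsupport f
  have hopen : IsOpen (Function.support f) := hf.isOpen_support
  obtain ⟨t, r, htc, hts, htr, hμ, hdisj⟩ :=
    Besicovitch.exists_disjoint_closedBall_covering_ae
      (volume : Measure (EuclideanSpace ℝ (Fin 3)))
      (fun x => {ρ : ℝ | closedBall x ρ ⊆ Function.support f ∧
        ∀ z ∈ closedBall x ρ, |f z - f x| ≤ ε / 4})
      (Function.support f)
      (by
        intro x hx δ hδ
        have h1 : ∀ᶠ z in nhds x, z ∈ Function.support f := hopen.mem_nhds hx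
        have h2 : ∀ᶠ z in nhds x, |f z - f x| < ε / 4 := by
          have := (Metric.tendsto_nhds.1 (hf.tendsto x)) (ε / 4) (by positivity)
          simpa [Real.dist_eq] using this
        obtain ⟨ρ, hρ, hb⟩ := Metric.nhds_basis_closedBall.eventually_iff.1 (h1.and h2)
        have hle : closedBall x (min ρ (δ / 2)) ⊆ closedBall x ρ :=
          closedBall_subset_closedBall (min_le_left _ _)
        refine ⟨min ρ (δ / 2), ⟨fun z hz => (hb (hle hz)).1, fun z hz => (hb (hle hz)).2.le⟩,
          lt_min hρ (by positivity), ?_⟩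
        have := min_le_right ρ (δ / 2)
        linarith)
      (fun _ => 1) (fun _ _ => one_pos)
  have : Countable t := htc.to_subtype
  let S : Finset t → Set (EuclideanSpace ℝ (Fin 3)) :=
    fun n => K \ ⋃ x ∈ n, closedBall (x : EuclideanSpace ℝ (Fin 3)) (r x)
  have hint : IntegrableOn f K := hf.continuousOn.integrableOn_compact hKc
  have hlim := tendsto_setIntegral_of_antitone (μ := volume) (f := f) (s := S)
    (fun n => hKc.isClosed.measurableSet.diff
      (Finset.measurableSet_biUnion n fun x _ => isClosed_closedBall.measurableSet))
    (by
      intro a b hab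
      exact Set.sdiff_subset_sdiff_right (Set.biUnion_subset_biUnion_left hab))
    ⟨∅, hint.mono_set Set.sdiff_subset⟩
  have hzero : ∫ p in ⋂ n, S n, f p = 0 := by
    apply setIntegral_eq_zero_of_ae_eq_zero
    have hae : ∀ᵐ p ∂(volume : Measure (EuclideanSpace ℝ (Fin 3))),
        p ∉ Function.support f \ ⋃ x ∈ t, closedBall x (r x) := measure_eq_zero_iff_ae_notMem.1 hμ
    filter_upwards [hae] with p hp hpS
    by_contra hne
    refine hp ⟨hne, ?_⟩
    intro hmem
    obtain ⟨x, hx, hpx⟩ := Set.mem_iUnion₂.1 hmem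
    have := (Set.mem_iInter.1 hpS {⟨x, hx⟩}).2
    exact this (by simpa using hpx)
  rw [hzero] at hlim
  obtain ⟨n, hn⟩ := (hlim.eventually (gt_mem_nhds hε)).exists
  let e := n.equivFin.symm
  refine ⟨n.card, fun i => ((e i : t) : EuclideanSpace ℝ (Fin 3)), fun i => r (e i : t), ?_, ?_, ?_, ?_, ?_⟩
  · intro i
    exact (htr _ (e i : t).2).2.1
  · intro i
    exact (htr _ (e i : t).2).1.1.trans hsK
  · intro i j hij
    refine Disjoint.mono interior_subset interior_subset
      (hdisj (e i : t).2 (e j : t).2 ?_)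
    intro h
    exact hij (e.injective (Subtype.ext (Subtype.ext h)))
  · have hU : (⋃ i, closedBall ((e i : t) : EuclideanSpace ℝ (Fin 3)) (r (e i : t))) =
        ⋃ x ∈ n, closedBall (x : EuclideanSpace ℝ (Fin 3)) (r x) := by
      rw [e.surjective.iUnion_comp
        (fun x : n => closedBall ((x : t) : EuclideanSpace ℝ (Fin 3)) (r (x : t)))]
      ext p
      simp
    rw [hU]
    exact hn
  · intro i
    have h := (htr _ (e i : t).2).1.2
    set c : EuclideanSpace ℝ (Fin 3) := ((e i : t) : EuclideanSpace ℝ (Fin 3)) with hc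
    have hpos : 0 < r c := (htr _ (e i : t).2).2.1
    have hle : var f (closedBall c (r c)) ≤ (f c + ε / 4) - (f c - ε / 4) := by
      refine csInf_le ⟨0, ?_⟩ ⟨_, _, rfl, ?_⟩
      · rintro d ⟨a, b, rfl, hab⟩
        have := hab ⟨c, mem_closedBall_self hpos.le, rfl⟩
        linarith [this.1, this.2]
      · rintro _ ⟨z, hz, rfl⟩
        have := abs_le.1 (h z hz)
        constructor <;> linarith [this.1, this.2]
    linarith
end

section
/- (Density of smoothed point-mass arrays.) Let f : ℝ³ → ℝ be continuous and nonnegative with nonempty compact connected support K, and let δ > 0, ε > 0. Then there exist k ≥ 1, points x₁, …, x_k ∈ ℝ³ with pairwise distinct norms (‖xᵢ‖ ≠ ‖x_j‖ for i ≠ j), radii rᵢ > 0, masses mᵢ > 0, and rᵢ-smoothings λᵢ of (xᵢ, mᵢ), such that λ = λ₁ + ⋯ + λ_k satisfies: (i) the open balls B_{rᵢ}(xᵢ) cover K; (ii) ∫_{ℝ³} |f − λ| < δ; (iii) the support of λ (namely ⋃ᵢ B̄_{rᵢ}(xᵢ)) is connected and its Hausdorff distance to K is < ε; (iv) |max_{y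 ∈ K} ‖y‖ − max_{y ∈ supp λ} ‖y‖| < ε; and (v) the unique index i₀ with ‖x_{i₀}‖ maximal satisfies r_{i₀} < ε/2. -/
open MeasureTheory Metric

noncomputable def tent3 (ρ : ℝ) (y : EuclideanSpace ℝ (Fin 3)) : ℝ := max 0 (ρ - ‖y‖)

lemma tent3_cont (ρ : ℝ) : Continuous (tent3 ρ) := by
  unfold tent3; fun_prop

lemma tent3_nonneg (ρ : ℝ) (y) : 0 ≤ tent3 ρ y := le_max_left _ _

lemma tent3_le {ρ : ℝ} (h : 0 ≤ ρ) (y) : tent3 ρ y ≤ ρ :=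
  max_le h (by linarith [norm_nonneg y])

lemma tent3_zero {ρ : ℝ} {y} (h : ρ ≤ ‖y‖) : tent3 ρ y = 0 :=
  max_eq_left (by linarith)

lemma tent3_pos {ρ : ℝ} {y} (h : ‖y‖ < ρ) : 0 < tent3 ρ y :=
  lt_max_of_lt_right (by linarith)

lemma tent3_lip (ρ : ℝ) (y z) : |tent3 ρ y - tent3 ρ z| ≤ ‖y - z‖ := by
  unfold tent3
  refine (abs_max_sub_max_le_max _ _ _ _).trans ?_
  simp only [sub_self, abs_zero]
  refine max_le (norm_nonneg _) ?_
  have := abs_norm_sub_norm_le z y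
  rw [norm_sub_rev] at this
  simpa using this

lemma tent3_supp {ρ a : ℝ} (ha : a ≠ 0) (x : EuclideanSpace ℝ (Fin 3)) :
    Function.support (fun y => a * tent3 ρ (y - x)) = ball x ρ := by
  ext y
  simp only [Function.mem_support, mem_ball, dist_eq_norm, ne_eq, mul_eq_zero, ha, false_or]
  constructor
  · intro h; by_contra h'; exact h (tent3_zero (not_lt.1 h'))
  · intro h; exact (tent3_pos h).ne'

lemma tent3_tsupp {ρ a : ℝ} (ha : a ≠ 0) (hρ : 0 < ρ) (x : EuclideanSpace ℝ (Fin 3)) :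
    tsupport (fun y => a * tent3 ρ (y - x)) = closedBall x ρ := by
  rw [tsupport, tent3_supp ha, closure_ball x hρ.ne']

lemma tent3_hcs {ρ : ℝ} (hρ : 0 < ρ) : HasCompactSupport (tent3 ρ) := by
  have := tent3_tsupp one_ne_zero hρ 0
  simp only [one_mul, sub_zero] at this
  change IsCompact (tsupport fun y => tent3 ρ y)
  rw [this]; exact isCompact_closedBall _ _

lemma tent3_int {ρ : ℝ} (hρ : 0 < ρ) : Integrable (tent3 ρ) :=
  (tent3_cont ρ).integrable_of_hasCompactSupport (tent3_hcs hρ)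

lemma tent3_ipos {ρ : ℝ} (hρ : 0 < ρ) : 0 < ∫ y, tent3 ρ y :=
  (tent3_cont ρ).integral_pos_of_hasCompactSupport_nonneg_nonzero (tent3_hcs hρ)
    (tent3_nonneg ρ) (x := 0) (tent3_pos (by simpa using hρ)).ne'

lemma tent3_smoothing {ρ w : ℝ} (hρ : 0 < ρ) (hw : 0 < w) (x : EuclideanSpace ℝ (Fin 3)) :
    IsSmoothing ρ w x (fun y => (w / ∫ z, tent3 ρ z) * tent3 ρ (y - x)) := by
  have hc := tent3_ipos hρ
  refine ⟨continuous_const.mul ((tent3_cont ρ).comp (continuous_id.sub continuous_const)),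
    fun y => mul_nonneg (div_pos hw hc).le (tent3_nonneg _ _), ?_, ?_, ?_⟩
  · intro y z h; simp only [tent3, h]
  · exact tent3_tsupp (div_pos hw hc).ne' hρ x
  · rw [integral_const_mul, integral_sub_right_eq_self (tent3 ρ) x]
    field_simp

lemma ptwise_est {k : ℕ} {ρ η ω : ℝ} (hρ : 0 < ρ) (f : EuclideanSpace ℝ (Fin 3) → ℝ)
    (hfi : Integrable f)
    (x : Fin k → EuclideanSpace ℝ (Fin 3)) (g : Fin k → EuclideanSpace ℝ (Fin 3) → ℝ)
    (hgi : ∀ i, Integrable (g i)) (hg0 : ∀ i z, 0 ≤ g i z) (hgs : ∀ z, ∑ i, g i z = f z)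
    (hgx : ∀ i z, g i z ≠ 0 → ‖z - x i‖ ≤ η)
    (hω : ∀ y z, ‖y - z‖ < ρ → |f y - f z| ≤ ω) (y) :
    |(∫ z, tent3 ρ z) * f y - ∑ i, (∫ z, g i z) * tent3 ρ (y - x i)|
      ≤ ω * (∫ z, tent3 ρ z) + η * ∫ z, f z := by
  have hT : Integrable (fun z => tent3 ρ (y - z)) := (tent3_int hρ).comp_sub_left y
  have e0 : ∫ z, tent3 ρ (y - z) = ∫ z, tent3 ρ z := integral_sub_left_eq_self (tent3 ρ) volume y
  have e1 : (∫ z, tent3 ρ z) * f y = ∫ z, tent3 ρ (y - z) * f y := by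
    rw [integral_mul_const, e0]
  have i2 : ∀ i, Integrable (fun z => g i z * tent3 ρ (y - x i)) := fun i => (hgi i).mul_const _
  have e2 : ∑ i, (∫ z, g i z) * tent3 ρ (y - x i) = ∫ z, ∑ i, g i z * tent3 ρ (y - x i) := by
    rw [integral_finset_sum _ (fun i _ => i2 i)]
    simp only [integral_mul_const]
  have e3 : ω * (∫ z, tent3 ρ z) + η * ∫ z, f z = ∫ z, (ω * tent3 ρ (y - z) + η * f z) := by
    rw [integral_add (hT.const_mul _) (hfi.const_mul _), integral_const_mul, integral_const_mul, e0]
  rw [e1, e2, e3, ← integral_sub (hT.mul_const _) (integrable_finset_sum _ (fun i _ => i2 i)),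
    ← Real.norm_eq_abs]
  refine norm_integral_le_of_norm_le ((hT.const_mul _).add (hfi.const_mul _))
    (Filter.Eventually.of_forall fun z => ?_)
  rw [Real.norm_eq_abs]
  have d : tent3 ρ (y - z) * f y - ∑ i, g i z * tent3 ρ (y - x i)
      = tent3 ρ (y - z) * (f y - f z) + ∑ i, g i z * (tent3 ρ (y - z) - tent3 ρ (y - x i)) := by
    simp only [mul_sub, Finset.sum_sub_distrib, ← Finset.sum_mul, hgs]
    ring
  rw [d]
  refine (abs_add_le _ _).trans (add_le_add ?_ ?_)
  · rw [abs_mul, abs_of_nonneg (tent3_nonneg _ _), mul_comm ω]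
    by_cases h : ‖y - z‖ < ρ
    · exact mul_le_mul_of_nonneg_left (hω y z h) (tent3_nonneg _ _)
    · rw [tent3_zero (not_lt.1 h)]; simp
  · rw [← hgs z, Finset.mul_sum]
    refine (Finset.abs_sum_le_sum_abs _ _).trans (Finset.sum_le_sum fun i _ => ?_)
    by_cases h : g i z = 0
    · simp [h]
    · rw [abs_mul, abs_of_nonneg (hg0 i z), mul_comm η]
      refine mul_le_mul_of_nonneg_left ?_ (hg0 i z)
      refine (tent3_lip _ _ _).trans ?_
      have : y - z - (y - x i) = -(z - x i) := by abel
      rw [this, norm_neg]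
      exact hgx i z h

lemma exists_g {k : ℕ} {η : ℝ} (f : EuclideanSpace ℝ (Fin 3) → ℝ)
    (hf : Continuous f) (hf0 : ∀ y, 0 ≤ f y) (hfi : Integrable f)
    (x : Fin k → EuclideanSpace ℝ (Fin 3)) (hx : tsupport f ⊆ ⋃ i, ball (x i) η) :
    ∃ g : Fin k → EuclideanSpace ℝ (Fin 3) → ℝ,
    (∀ i, Integrable (g i)) ∧ (∀ i z, 0 ≤ g i z) ∧ (∀ z, ∑ i, g i z = f z) ∧
    (∀ i z, g i z ≠ 0 → ‖z - x i‖ ≤ η) := by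
  have hm : ∀ i, Measurable fun z => tent3 η (z - x i) := fun i =>
    ((tent3_cont η).comp (continuous_id.sub continuous_const)).measurable
  have hS0 : ∀ z, 0 ≤ ∑ j, tent3 η (z - x j) := fun z =>
    Finset.sum_nonneg fun j _ => tent3_nonneg _ _
  have h0 : ∀ i z, 0 ≤ f z * (tent3 η (z - x i) / ∑ j, tent3 η (z - x j)) := fun i z =>
    mul_nonneg (hf0 z) (div_nonneg (tent3_nonneg _ _) (hS0 z))
  refine ⟨fun i z => f z * (tent3 η (z - x i) / ∑ j, tent3 η (z - x j)), ?_, h0, ?_, ?_⟩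
  · intro i
    refine hfi.mono' ?_ (Filter.Eventually.of_forall fun z => ?_)
    · exact (hf.measurable.mul ((hm i).div
        (Finset.measurable_fun_sum _ fun j _ => hm j))).aestronglyMeasurable
    · rw [Real.norm_eq_abs, abs_of_nonneg (h0 i z)]
      refine mul_le_of_le_one_right (hf0 z) (div_le_one_of_le₀ ?_ (hS0 z))
      exact Finset.single_le_sum (f := fun j => tent3 η (z - x j))
        (fun j _ => tent3_nonneg _ _) (Finset.mem_univ i)
  · intro z
    rw [← Finset.mul_sum, ← Finset.sum_div]
    by_cases hz : f z = 0
    · simp [hz]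
    · obtain ⟨i, hi⟩ := Set.mem_iUnion.1 (hx (subset_tsupport f hz))
      rw [mem_ball, dist_eq_norm] at hi
      have : 0 < ∑ j, tent3 η (z - x j) := Finset.sum_pos' (fun j _ => tent3_nonneg _ _)
        ⟨i, Finset.mem_univ _, tent3_pos hi⟩
      rw [div_self this.ne', mul_one]
  · intro i z h
    by_contra h'
    apply h
    simp [tent3_zero (not_le.1 h').le]

lemma exists_norm_pt (y : EuclideanSpace ℝ (Fin 3)) {t : ℝ} (ht : ‖y‖ < t) :
    ∃ x : EuclideanSpace ℝ (Fin 3), ‖x‖ = t ∧ dist x y = t - ‖y‖ := by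
  have ht0 : 0 < t := (norm_nonneg y).trans_lt ht
  by_cases hy : y = 0
  · obtain ⟨x, hx⟩ := exists_norm_eq (EuclideanSpace ℝ (Fin 3)) ht0.le
    exact ⟨x, hx, by simp [hy, hx]⟩
  · have hn : 0 < ‖y‖ := norm_pos_iff.2 hy
    refine ⟨(t / ‖y‖) • y, ?_, ?_⟩
    · rw [norm_smul, Real.norm_of_nonneg (by positivity)]; field_simp
    · have : (t / ‖y‖) • y - y = (t / ‖y‖ - 1) • y := by rw [sub_smul, one_smul]
      rw [dist_eq_norm, this, norm_smul, Real.norm_of_nonneg]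
      · field_simp
      · rw [sub_nonneg, le_div_iff₀ hn]; linarith

lemma exists_perturb {η : ℝ} (hη : 0 < η) (s : Finset (EuclideanSpace ℝ (Fin 3))) :
    ∃ x : EuclideanSpace ℝ (Fin 3) → EuclideanSpace ℝ (Fin 3),
      (∀ y ∈ s, dist (x y) y < η) ∧ ∀ y ∈ s, ∀ z ∈ s, y ≠ z → ‖x y‖ ≠ ‖x z‖ := by
  classical
  induction s using Finset.induction_on with
  | empty => exact ⟨id, by simp, by simp⟩
  | insert a s ha ih =>
    obtain ⟨x, h1, h2⟩ := ih
    obtain ⟨t, ht, hts⟩ := (Set.Ioo_infinite (show ‖a‖ < ‖a‖ + η by linarith)).exists_notMem_finset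
      (s.image fun y => ‖x y‖)
    obtain ⟨p, hp, hpa⟩ := exists_norm_pt a ht.1
    have hne : ∀ y ∈ s, y ≠ a := fun y hy h => ha (h ▸ hy)
    have hpn : ∀ y ∈ s, ‖x y‖ ≠ t := fun y hy h => hts (Finset.mem_image.2 ⟨y, hy, h⟩)
    refine ⟨Function.update x a p, ?_, ?_⟩
    · intro y hy
      rcases Finset.mem_insert.1 hy with rfl | hy
      · simp only [Function.update_self]; rw [hpa]; linarith [ht.2]
      · rw [Function.update_of_ne (hne y hy)]; exact h1 y hy
    · intro y hy z hz hyz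
      rcases Finset.mem_insert.1 hy with hya | hy <;> rcases Finset.mem_insert.1 hz with hza | hz
      · exact absurd (hya.trans hza.symm) hyz
      · rw [hya, Function.update_self, Function.update_of_ne (hne z hz), hp]; exact (hpn z hz).symm
      · rw [hza, Function.update_self, Function.update_of_ne (hne y hy), hp]; exact hpn y hy
      · rw [Function.update_of_ne (hne y hy), Function.update_of_ne (hne z hz)]
        exact h2 y hy z hz hyz

lemma exists_pts {η : ℝ} (hη : 0 < η) (K : Set (EuclideanSpace ℝ (Fin 3)))
    (hKne : K.Nonempty) (hKc : IsCompact K) :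
    ∃ (k : ℕ) (_ : 1 ≤ k) (x : Fin k → EuclideanSpace ℝ (Fin 3)),
      (∀ i j, i ≠ j → ‖x i‖ ≠ ‖x j‖) ∧ (K ⊆ ⋃ i, ball (x i) η) ∧
      (∀ i, ∃ y ∈ K, dist (x i) y < η) := by
  obtain ⟨t, htK, htc⟩ := hKc.elim_nhds_subcover (fun y => ball y (η / 2))
    (fun y _ => ball_mem_nhds y (half_pos hη))
  obtain ⟨x, h1, h2⟩ := exists_perturb (half_pos hη) t
  have hcov : K ⊆ ⋃ i, ball (x (t.equivFin.symm i)) η := by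
    intro z hz
    obtain ⟨y, hy, hzy⟩ := Set.mem_iUnion₂.1 (htc hz)
    refine Set.mem_iUnion.2 ⟨t.equivFin ⟨y, hy⟩, ?_⟩
    simp only [Equiv.symm_apply_apply, mem_ball] at hzy ⊢
    have := h1 y hy
    rw [dist_comm] at this
    linarith [dist_triangle z y (x y)]
  refine ⟨t.card, ?_, fun i => x (t.equivFin.symm i), ?_, hcov, ?_⟩
  · obtain ⟨z, hz⟩ := hKne
    obtain ⟨i, -⟩ := Set.mem_iUnion.1 (hcov hz)
    exact (Nat.zero_le _).trans_lt i.2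
  · intro i j hij
    refine h2 _ (t.equivFin.symm i).2 _ (t.equivFin.symm j).2 fun h => hij ?_
    exact t.equivFin.symm.injective (Subtype.ext h)
  · intro i
    refine ⟨_, htK _ (t.equivFin.symm i).2, ?_⟩
    linarith [h1 _ (t.equivFin.symm i).2]

lemma l1_est {k : ℕ} {ρ η ω τ : ℝ} (hρ : 0 < ρ) (hτ : 0 ≤ τ) (f : EuclideanSpace ℝ (Fin 3) → ℝ)
    (hfi : Integrable f) (hKc : IsCompact (tsupport f)) (hη : ρ + η ≤ 1)
    (x : Fin k → EuclideanSpace ℝ (Fin 3)) (g : Fin k → EuclideanSpace ℝ (Fin 3) → ℝ)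
    (hgi : ∀ i, Integrable (g i)) (hg0 : ∀ i z, 0 ≤ g i z) (hgs : ∀ z, ∑ i, g i z = f z)
    (hgx : ∀ i z, g i z ≠ 0 → ‖z - x i‖ ≤ η)
    (hxK : ∀ i, ∃ y ∈ tsupport f, dist (x i) y < η)
    (hω : ∀ y z, ‖y - z‖ < ρ → |f y - f z| ≤ ω) :
    (∫ y, |f y - ∑ i, (((∫ z, g i z) + τ) / ∫ z, tent3 ρ z) * tent3 ρ (y - x i)|)
      ≤ (ω + (η * (∫ z, f z) + k * τ * ρ) / ∫ z, tent3 ρ z) *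
        volume.real (cthickening 1 (tsupport f)) := by
  have hc := tent3_ipos hρ
  set c := ∫ z, tent3 ρ z with hcdef
  set h : EuclideanSpace ℝ (Fin 3) → ℝ :=
    fun y => |f y - ∑ i, (((∫ z, g i z) + τ) / c) * tent3 ρ (y - x i)| with hh
  have hpt : ∀ y, h y ≤ ω + (η * (∫ z, f z) + k * τ * ρ) / c := by
    intro y
    have e := ptwise_est hρ f hfi x g hgi hg0 hgs hgx hω y
    rw [← hcdef] at e
    have e2 : |∑ i, τ * tent3 ρ (y - x i)| ≤ k * τ * ρ := by
      rw [abs_of_nonneg (Finset.sum_nonneg fun i _ => mul_nonneg hτ (tent3_nonneg _ _))]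
      refine (Finset.sum_le_card_nsmul _ _ (τ * ρ) fun i _ =>
        mul_le_mul_of_nonneg_left (tent3_le hρ.le _) hτ).trans ?_
      simp [mul_assoc]
    have e3 : f y - ∑ i, (((∫ z, g i z) + τ) / c) * tent3 ρ (y - x i)
        = ((c * f y - ∑ i, (∫ z, g i z) * tent3 ρ (y - x i)) - ∑ i, τ * tent3 ρ (y - x i)) / c := by
      rw [sub_sub, ← Finset.sum_add_distrib, sub_div, mul_div_cancel_left₀ _ hc.ne',
        Finset.sum_div]
      congr 1
      refine Finset.sum_congr rfl fun i _ => ?_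
      ring
    have e4 : ω + (η * (∫ z, f z) + k * τ * ρ) / c
        = (ω * c + η * (∫ z, f z) + k * τ * ρ) / c := by field_simp; ring
    rw [hh]
    simp only
    rw [e3, e4, abs_div, abs_of_pos hc]
    gcongr
    exact (abs_sub _ _).trans (add_le_add e e2)
  have hsupp : ∀ y, y ∉ cthickening 1 (tsupport f) → h y = 0 := by
    intro y hy
    have hfy : f y = 0 := by
      by_contra h0
      exact hy (self_subset_cthickening _ (subset_tsupport f h0))
    have : ∀ i, tent3 ρ (y - x i) = 0 := by
      intro i
      refine tent3_zero ?_
      by_contra h0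
      obtain ⟨z, hz, hxz⟩ := hxK i
      refine hy (mem_cthickening_of_dist_le y z 1 _ hz ?_)
      have := dist_triangle y (x i) z
      rw [dist_eq_norm y (x i)] at this
      linarith
    simp [hh, hfy, this]
  rw [← setIntegral_eq_integral_of_forall_compl_eq_zero hsupp]
  have hfin : volume (cthickening 1 (tsupport f)) < ⊤ := hKc.cthickening.measure_lt_top
  refine (le_abs_self _).trans ?_
  rw [← Real.norm_eq_abs]
  refine norm_setIntegral_le_of_norm_le_const hfin fun y _ => ?_
  rw [Real.norm_eq_abs, hh]
  simp only [abs_abs]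
  exact hpt y

theorem SPMA_density (f : EuclideanSpace ℝ (Fin 3) → ℝ)
    (hf : Continuous f) (hf0 : ∀ y, 0 ≤ f y)
    (K : Set (EuclideanSpace ℝ (Fin 3))) (hK : K = tsupport f)
    (hKne : K.Nonempty) (hKc : IsCompact K) (hKconn : IsConnected K)
    (δ ε : ℝ) (hδ : 0 < δ) (hε : 0 < ε) :
    ∃ (k : ℕ) (_ : 1 ≤ k) (x : Fin k → EuclideanSpace ℝ (Fin 3)) (r m : Fin k → ℝ)
      (lam : Fin k → EuclideanSpace ℝ (Fin 3) → ℝ),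
      (∀ i j, i ≠ j → ‖x i‖ ≠ ‖x j‖) ∧
      (∀ i, 0 < r i) ∧ (∀ i, 0 < m i) ∧
      (∀ i, IsSmoothing (r i) (m i) (x i) (lam i)) ∧
      -- (i) the open balls cover `K`
      (K ⊆ ⋃ i, ball (x i) (r i)) ∧
      -- (ii) `L¹`-closeness
      (∫ y, |f y - ∑ i, lam i y|) < δ ∧
      -- (iii) the support of `λ` is connected and Hausdorff-close to `K`
      IsConnected (⋃ i, closedBall (x i) (r i)) ∧
      Metric.hausdorffDist (⋃ i, closedBall (x i) (r i)) K < ε ∧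
      -- (iv) the Brillouin radii are `ε`-close
      |(⨆ y : K, ‖(y : EuclideanSpace ℝ (Fin 3))‖) -
        (⨆ y : (⋃ i, closedBall (x i) (r i)), ‖(y : EuclideanSpace ℝ (Fin 3))‖)| < ε ∧
      -- (v) the extremal ball has radius `< ε/2`
      (∃ i₀ : Fin k, (∀ j, j ≠ i₀ → ‖x j‖ < ‖x i₀‖) ∧ r i₀ < ε / 2) := by
  have hcs : HasCompactSupport f := by rw [HasCompactSupport, ← hK]; exact hKc
  have hfi : Integrable f := hf.integrable_of_hasCompactSupport hcs
  have huc : UniformContinuous f := hcs.uniformContinuous_of_continuous hf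
  set V := volume.real (cthickening 1 (tsupport f)) with hV
  have hV0 : 0 ≤ V := measureReal_nonneg
  set ω := δ / (4 * (V + 1)) with hωd
  have hω : 0 < ω := by positivity
  obtain ⟨ρ₀, hρ₀, hρ₀'⟩ := Metric.uniformContinuous_iff.1 huc ω hω
  obtain ⟨ρ, hρ, hρa⟩ : ∃ ρ, 0 < ρ ∧ ρ < min ρ₀ (min (ε / 4) (1 / 2)) :=
    exists_between (by positivity)
  simp only [lt_min_iff] at hρa
  obtain ⟨hρ1, hρ2, hρ3⟩ := hρa
  have hc := tent3_ipos hρ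
  set c := ∫ z, tent3 ρ z with hcd
  have hF : 0 ≤ ∫ z, f z := integral_nonneg hf0
  set F := ∫ z, f z with hFd
  obtain ⟨η, hη, hηa⟩ : ∃ η, 0 < η ∧ η < min ρ (ω * c / (F + 1)) :=
    exists_between (by positivity)
  obtain ⟨hη1, hη2⟩ := lt_min_iff.1 hηa
  obtain ⟨k, hk, x, hxn, hxc, hxK⟩ := exists_pts hη K hKne hKc
  obtain ⟨g, hgi, hg0, hgs, hgx⟩ := exists_g f hf hf0 hfi x (hK ▸ hxc)
  have hk0 : (0 : ℝ) < k := by exact_mod_cast hk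
  set τ := ω * c / (k * ρ) with hτd
  have hτ : 0 < τ := by positivity
  have hmp : ∀ i, 0 < (∫ z, g i z) + τ := fun i => add_pos_of_nonneg_of_pos
    (integral_nonneg (hg0 i)) hτ
  have hcovb : K ⊆ ⋃ i, ball (x i) ρ :=
    hxc.trans (Set.iUnion_mono fun i => ball_subset_ball hη1.le)
  have hcov : K ⊆ ⋃ i, closedBall (x i) ρ :=
    hcovb.trans (Set.iUnion_mono fun i => ball_subset_closedBall)
  have hnear : ∀ z ∈ ⋃ i, closedBall (x i) ρ, ∃ y ∈ K, dist z y ≤ 2 * ρ := by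
    intro z hz
    obtain ⟨i, hi⟩ := Set.mem_iUnion.1 hz
    obtain ⟨y, hy, hxy⟩ := hxK i
    refine ⟨y, hy, ?_⟩
    rw [mem_closedBall] at hi
    linarith [dist_triangle z (x i) y]
  refine ⟨k, hk, x, fun _ => ρ, fun i => (∫ z, g i z) + τ,
    fun i y => (((∫ z, g i z) + τ) / c) * tent3 ρ (y - x i), hxn, fun _ => hρ, hmp,
    fun i => tent3_smoothing hρ (hmp i) (x i), hcovb, ?_, ?_, ?_, ?_, ?_⟩
  · have := l1_est hρ hτ.le f hfi (hK ▸ hKc) (by linarith) x g hgi hg0 hgs hgx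
      (hK ▸ hxK) (ω := ω) (fun y z h => by
        have := hρ₀' (a := y) (b := z) (by rw [dist_eq_norm]; linarith)
        rw [Real.dist_eq] at this; exact this.le)
    refine this.trans_lt ?_
    rw [← hcd, ← hFd, ← hV]
    have a1 : η * F ≤ ω * c := by
      rw [lt_div_iff₀ (by positivity)] at hη2
      nlinarith
    have a2 : k * τ * ρ = ω * c := by rw [hτd]; field_simp
    have a3 : ω + (η * F + k * τ * ρ) / c ≤ 3 * ω := by
      rw [a2]
      have : (η * F + ω * c) / c ≤ 2 * ω := by
        rw [div_le_iff₀ hc]; linarith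
      linarith
    have a4 : ω * (4 * (V + 1)) = δ := by rw [hωd]; field_simp
    have := mul_le_mul_of_nonneg_right a3 hV0
    nlinarith
  · have hU : (⋃ i, closedBall (x i) ρ) = ⋃ i, (K ∪ closedBall (x i) ρ) := by
      apply Set.Subset.antisymm
      · exact Set.iUnion_mono fun i => Set.subset_union_right
      · exact Set.iUnion_subset fun i => Set.union_subset hcov
          (Set.subset_iUnion (fun i => closedBall (x i) ρ) i)
    obtain ⟨p, hp⟩ := hKne
    refine ⟨⟨p, hcov hp⟩, ?_⟩
    rw [hU]
    refine isPreconnected_iUnion ⟨p, Set.mem_iInter.2 fun i => Or.inl hp⟩ fun i => ?_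
    obtain ⟨y, hy, hxy⟩ := hxK i
    refine IsPreconnected.union y hy ?_ hKconn.isPreconnected
      (convex_closedBall (x i) ρ).isPreconnected
    rw [mem_closedBall, dist_comm]; linarith
  · refine lt_of_le_of_lt (hausdorffDist_le_of_mem_dist (r := 2 * ρ) (by positivity) hnear ?_)
      (by linarith)
    intro z hz
    exact ⟨z, hcov hz, by rw [dist_self]; positivity⟩
  · obtain ⟨p, hp⟩ := hKne
    haveI : Nonempty K := ⟨⟨p, hp⟩⟩
    haveI : Nonempty (⋃ i, closedBall (x i) ρ) := ⟨⟨p, hcov hp⟩⟩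
    have hbK : BddAbove (Set.range fun y : K => ‖(y : EuclideanSpace ℝ (Fin 3))‖) := by
      obtain ⟨C, hC⟩ := hKc.isBounded.exists_norm_le
      exact ⟨C, by rintro _ ⟨y, rfl⟩; exact hC y y.2⟩
    have hUle : ∀ z : (⋃ i, closedBall (x i) ρ), ‖(z : EuclideanSpace ℝ (Fin 3))‖ ≤
        (⨆ y : K, ‖(y : EuclideanSpace ℝ (Fin 3))‖) + 2 * ρ := by
      rintro ⟨z, hz⟩
      obtain ⟨y, hy, hzy⟩ := hnear z hz
      have h1 := le_ciSup hbK ⟨y, hy⟩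
      have h2 := norm_sub_norm_le z y
      rw [dist_eq_norm] at hzy
      simp only at h1 ⊢
      linarith
    have s1 := ciSup_le hUle
    have s2 : (⨆ y : K, ‖(y : EuclideanSpace ℝ (Fin 3))‖) ≤
        ⨆ y : (⋃ i, closedBall (x i) ρ), ‖(y : EuclideanSpace ℝ (Fin 3))‖ :=
      ciSup_le fun y => le_ciSup
        (f := fun y : (⋃ i, closedBall (x i) ρ) => ‖(y : EuclideanSpace ℝ (Fin 3))‖)
        ⟨_, by rintro _ ⟨z, rfl⟩; exact hUle z⟩ ⟨y, hcov y.2⟩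
    rw [abs_lt]
    constructor <;> linarith
  · haveI : Nonempty (Fin k) := ⟨⟨0, hk⟩⟩
    obtain ⟨i₀, h⟩ := Finite.exists_max fun i => ‖x i‖
    exact ⟨i₀, fun j hj => lt_of_le_of_ne (h j) (hxn j i₀ hj), by linarith⟩
end

section
/- (Theorem 1, parts (a)–(d).) Let f : ℝ³ → ℝ be continuous and nonnegative with nonempty compact connected support, and let ε > 0 and N > 0. Then there exists a smoothed point-mass array λ = λ₁ + ⋯ + λ_k (each λᵢ an rᵢ-smoothing of a point mass (xᵢ, mᵢ), with the centers xᵢ having pairwise distinct norms and the ball about the unique center of maximal norm having radius < ε/2) such that: (a) ∫_{ℝ³} |f − λ| < ε; (b) the Hausdorff distance between supp f and supp λ is < ε; (c) |V_f(x) − V_λ(x)| < ε for every x in the closed ball B̄_N(0); and (d) |max_{y ∈ supp f} ‖y‖ − max_{y ∈ supp λ} ‖y‖| < ε (i.e., the Brillouin radii of f and λ differ by less than ε). -/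
open MeasureTheory Metric

abbrev E3 := EuclideanSpace ℝ (Fin 3)

lemma inv_norm_integrableOn (r : ℝ) : IntegrableOn (fun z : E3 => ‖z‖⁻¹) (closedBall 0 r) := by
  have h : LocallyIntegrable (fun z : E3 => ‖z‖⁻¹) := by
    refine locallyIntegrable_of_norm_le_rpow (C := 1) (α := 1) ?_ ?_ ?_ ?_
    · simp
    · simp
    · refine Filter.Eventually.of_forall fun x => ?_
      simp [Real.rpow_neg_one]
    · exact (measurable_norm.inv).aestronglyMeasurable
  exact h.integrableOn_isCompact (isCompact_closedBall _ _)

lemma pot_bound (R N : ℝ) : ∃ C : ℝ, 0 < C ∧ ∀ (u : E3 → ℝ) (s : ℝ), Continuous u → 0 ≤ s →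
    (∀ y, |u y| ≤ s) → (∀ y, R < ‖y‖ → u y = 0) →
    (∫ y, |u y|) ≤ C * s ∧ ∀ p : E3, ‖p‖ ≤ N → Integrable (fun y => u y / ‖p - y‖) ∧
      |∫ y, u y / ‖p - y‖| ≤ C * s := by
  set A : ℝ := ∫ z, (closedBall (0:E3) R).indicator (fun _ => (1:ℝ)) z with hA
  set B : ℝ := ∫ z, (closedBall (0:E3) (R+N)).indicator (fun z => ‖z‖⁻¹) z with hB
  have iA : Integrable ((closedBall (0:E3) R).indicator (fun _ => (1:ℝ))) := by
    rw [integrable_indicator_iff measurableSet_closedBall]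
    exact continuousOn_const.integrableOn_compact (isCompact_closedBall _ _)
  have iB : Integrable ((closedBall (0:E3) (R+N)).indicator (fun z => ‖z‖⁻¹)) := by
    rw [integrable_indicator_iff measurableSet_closedBall]
    exact inv_norm_integrableOn _
  have hA0 : 0 ≤ A := integral_nonneg fun z => Set.indicator_nonneg (by simp) z
  have hB0 : 0 ≤ B := integral_nonneg fun z => Set.indicator_nonneg (by simp) z
  refine ⟨A + B + 1, by positivity, fun u s hu hs hus huR => ⟨?_, fun p hp => ?_⟩⟩
  · have : (∫ y, |u y|) ≤ ∫ y, s * (closedBall (0:E3) R).indicator (fun _ => (1:ℝ)) y := by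
      refine integral_mono_of_nonneg (Filter.Eventually.of_forall fun y => abs_nonneg _)
        (iA.const_mul s) (Filter.Eventually.of_forall fun y => ?_)
      by_cases hy : ‖y‖ ≤ R
      · simpa [Set.indicator, hy] using hus y
      · simp [Set.indicator, hy, huR y (not_le.1 hy)]
    rw [integral_const_mul] at this
    nlinarith
  · have key : ∀ z : E3, ‖u (p - z) / ‖z‖‖ ≤
        s * (closedBall (0:E3) (R+N)).indicator (fun z => ‖z‖⁻¹) z := by
      intro z
      by_cases hz : ‖z‖ ≤ R + N
      · simp only [Set.indicator, mem_closedBall, dist_zero_right, hz, if_true, abs_mul, abs_inv, abs_norm,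
          div_eq_mul_inv, Real.norm_eq_abs]
        exact mul_le_mul_of_nonneg_right (hus _) (by positivity)
      · have : u (p - z) = 0 := huR _ (by
          have := norm_sub_norm_le z p
          rw [norm_sub_rev] at this
          linarith)
        simp [Set.indicator, hz, this]
    have i1 : Integrable (fun z => u (p - z) / ‖z‖) := by
      refine (iB.const_mul s).mono' ?_ (Filter.Eventually.of_forall key)
      have : Measurable (fun z => u (p - z)) := (by fun_prop : Continuous fun z => u (p - z)).measurable
      exact (this.div measurable_norm).aestronglyMeasurable
    have i2 := i1.comp_sub_left p
    simp only [sub_sub_cancel] at i2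
    refine ⟨i2, ?_⟩
    have e : (∫ y, u y / ‖p - y‖) = ∫ z, u (p - z) / ‖z‖ := by
      rw [← integral_sub_left_eq_self (fun z => u (p - z) / ‖z‖) volume p]
      simp only [sub_sub_cancel]
    rw [e, ← Real.norm_eq_abs]
    have := norm_integral_le_of_norm_le (iB.const_mul s) (Filter.Eventually.of_forall key)
    rw [integral_const_mul] at this
    nlinarith

/-- normalised cone bump -/
lemma bump_exists (δ : ℝ) (hδ : 0 < δ) : ∃ c : ℝ, 0 < c ∧
    (∫ y : E3, c * max 0 (δ - ‖y‖)) = 1 := by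
  have h : 0 < ∫ y : E3, max 0 (δ - ‖y‖) := by
    refine Continuous.integral_pos_of_hasCompactSupport_nonneg_nonzero (x := 0) (by fun_prop) ?_
      (fun y => le_max_left _ _) (by simp [hδ.not_ge])
    refine HasCompactSupport.intro (isCompact_closedBall 0 δ) fun y hy => ?_
    simp at hy
    exact max_eq_left (by linarith)
  refine ⟨_, inv_pos.2 h, ?_⟩
  rw [integral_const_mul, inv_mul_cancel₀ h.ne']

lemma bump_smoothing (δ c m : ℝ) (hδ : 0 < δ) (hc : 0 < c) (hm : 0 < m)
    (h1 : (∫ y : E3, c * max 0 (δ - ‖y‖)) = 1) (x : E3) :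
    IsSmoothing δ m x (fun y => m * (c * max 0 (δ - ‖y - x‖))) := by
  refine ⟨by fun_prop, fun y => by positivity, fun y z h => by simp only [h], ?_, ?_⟩
  · rw [tsupport, ← closure_ball x hδ.ne']
    congr 1
    ext y
    simp only [Function.mem_support, mem_ball, dist_eq_norm]
    constructor
    · intro h
      by_contra h'
      exact h (by rw [max_eq_left (by linarith)]; simp)
    · intro h
      have : 0 < max 0 (δ - ‖y - x‖) := lt_max_of_lt_right (by linarith)
      positivity
  · rw [integral_const_mul, integral_sub_right_eq_self (fun y => c * max 0 (δ - ‖y‖)) x, h1, mul_one]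

lemma exists_norm_avoid (x : E3) (η : ℝ) (hη : 0 < η) (S : Finset ℝ) :
    ∃ z : E3, dist z x < η ∧ ‖z‖ ∉ S := by
  obtain ⟨v, hv, hv'⟩ : ∃ v : E3, ‖v‖ = 1 ∧ x = ‖x‖ • v := by
    by_cases hx : x = 0
    · exact ⟨EuclideanSpace.single 0 1, by simp, by simp [hx]⟩
    · have : ‖x‖ ≠ 0 := norm_ne_zero_iff.2 hx
      exact ⟨‖x‖⁻¹ • x, by simp [norm_smul, this], by simp [smul_smul, this]⟩
  have hinf : (Set.Ioo ‖x‖ (‖x‖ + η)).Infinite := Set.Ioo_infinite (by linarith)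
  obtain ⟨t, ht, htS⟩ := hinf.exists_notMem_finset S
  refine ⟨t • v, ?_, ?_⟩
  · rw [dist_eq_norm]
    nth_rw 1 [hv']
    rw [← sub_smul, norm_smul, hv, Real.norm_eq_abs, mul_one, abs_lt]
    constructor <;> linarith [ht.1, ht.2]
  · rw [norm_smul, hv, Real.norm_eq_abs, abs_of_nonneg (by linarith [ht.1, norm_nonneg x]), mul_one]
    exact htS

lemma perturb {k : ℕ} (x : Fin k → E3) (η : ℝ) (hη : 0 < η) :
    ∃ z : Fin k → E3, (∀ i, dist (z i) (x i) < η) ∧ ∀ i j, i ≠ j → ‖z i‖ ≠ ‖z j‖ := by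
  suffices h : ∀ s : Finset (Fin k), ∃ z : Fin k → E3, (∀ i, dist (z i) (x i) < η) ∧
      ∀ i ∈ s, ∀ j ∈ s, i ≠ j → ‖z i‖ ≠ ‖z j‖ by
    obtain ⟨z, h1, h2⟩ := h Finset.univ
    exact ⟨z, h1, fun i j => h2 i (Finset.mem_univ _) j (Finset.mem_univ _)⟩
  intro s
  induction s using Finset.induction_on with
  | empty => exact ⟨x, by simpa using fun _ => hη, by simp⟩
  | insert a s ha ih =>
    obtain ⟨z, h1, h2⟩ := ih
    obtain ⟨w, hw, hwS⟩ := exists_norm_avoid (x a) η hη (s.image fun i => ‖z i‖)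
    have hw' : ∀ i ∈ s, ‖z i‖ ≠ ‖w‖ := fun i hi h => hwS (Finset.mem_image.2 ⟨i, hi, h⟩)
    have hne : ∀ i ∈ s, i ≠ a := fun i hi h => ha (h ▸ hi)
    refine ⟨Function.update z a w, fun i => ?_, ?_⟩
    · by_cases hi : i = a
      · subst hi; simpa using hw
      · simpa [hi] using h1 i
    · intro i hi j hj hij
      rcases Finset.mem_insert.1 hi with rfl | hi' <;> rcases Finset.mem_insert.1 hj with rfl | hj'
      · exact absurd rfl hij
      · simpa [hne j hj'] using (hw' j hj').symm
      · simpa [hne i hi'] using hw' i hi'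
      · simpa [hne i hi', hne j hj'] using h2 i hi' j hj' hij

lemma sup_close (S T : Set E3) (ρ : ℝ) (hS : S.Nonempty) (hT : T.Nonempty)
    (bS : Bornology.IsBounded S) (bT : Bornology.IsBounded T)
    (h1 : ∀ x ∈ S, ∃ y ∈ T, dist x y ≤ ρ) (h2 : ∀ x ∈ T, ∃ y ∈ S, dist x y ≤ ρ) :
    |(⨆ y : S, ‖(y : E3)‖) - (⨆ y : T, ‖(y : E3)‖)| ≤ ρ := by
  have aux : ∀ S T : Set E3, S.Nonempty → Bornology.IsBounded T →
      (∀ x ∈ S, ∃ y ∈ T, dist x y ≤ ρ) → (⨆ y : S, ‖(y : E3)‖) ≤ (⨆ y : T, ‖(y : E3)‖) + ρ := by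
    intro S T hS bT h
    have := hS.to_subtype
    refine ciSup_le fun x => ?_
    obtain ⟨y, hy, hxy⟩ := h x x.2
    have hb : BddAbove (Set.range fun y : T => ‖(y : E3)‖) := by
      obtain ⟨C, hC⟩ := bT.exists_norm_le
      exact ⟨C, by rintro _ ⟨y, rfl⟩; exact hC y y.2⟩
    have := le_ciSup hb ⟨y, hy⟩
    have h3 := norm_sub_norm_le (x : E3) y
    rw [dist_eq_norm] at hxy
    simp only at this
    linarith
  rw [abs_le]
  constructor <;> linarith [aux S T hS bT h1, aux T S hT bS h2]

/-- decomposition of `f` into pieces localised near the points of a net -/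
lemma pieces (f : E3 → ℝ) (hf : Continuous f) (hf0 : ∀ y, 0 ≤ f y) (hfi : Integrable f)
    {k : ℕ} (x : Fin k → E3) (η : ℝ) (hx : ∀ y ∈ tsupport f, ∃ i, dist y (x i) < η) :
    ∃ g : Fin k → E3 → ℝ, (∀ i y, 0 ≤ g i y) ∧ (∀ i, Integrable (g i)) ∧
      (∀ y, ∑ i, g i y = f y) ∧ ∀ i y, g i y ≠ 0 → dist y (x i) < η := by
  have hpos : ∀ y i, 0 ≤ max 0 (η - dist y (x i)) := fun y i => le_max_left _ _
  have hg0 : ∀ i y, 0 ≤ f y * (max 0 (η - dist y (x i)) / ∑ j, max 0 (η - dist y (x j))) :=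
    fun i y => mul_nonneg (hf0 y) (div_nonneg (hpos _ _) (Finset.sum_nonneg fun j _ => hpos _ _))
  refine ⟨fun i y => f y * (max 0 (η - dist y (x i)) / ∑ j, max 0 (η - dist y (x j))),
    hg0, fun i => ?_, fun y => ?_, fun i y h => ?_⟩
  · refine hfi.mono' ?_ (Filter.Eventually.of_forall fun y => ?_)
    · have m1 : Measurable fun y : E3 => max 0 (η - dist y (x i)) :=
        (by fun_prop : Continuous fun y : E3 => max 0 (η - dist y (x i))).measurable
      have m2 : Measurable fun y : E3 => ∑ j, max 0 (η - dist y (x j)) :=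
        (by fun_prop : Continuous fun y : E3 => ∑ j, max 0 (η - dist y (x j))).measurable
      exact (hf.measurable.mul (m1.div m2)).aestronglyMeasurable
    · rw [Real.norm_eq_abs, abs_of_nonneg (hg0 i y)]
      refine mul_le_of_le_one_right (hf0 y) (div_le_one_of_le₀ ?_
        (Finset.sum_nonneg fun j _ => hpos _ _))
      exact Finset.single_le_sum (f := fun j => max 0 (η - dist y (x j)))
        (fun j _ => hpos y j) (Finset.mem_univ i)
  · rw [← Finset.mul_sum, ← Finset.sum_div]
    by_cases hy : f y = 0
    · simp [hy]
    · obtain ⟨i, hi⟩ := hx y (subset_tsupport f hy)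
      have : 0 < ∑ j, max 0 (η - dist y (x j)) :=
        Finset.sum_pos' (fun j _ => hpos y j) ⟨i, Finset.mem_univ _, lt_max_of_lt_right (by linarith)⟩
      rw [div_self this.ne', mul_one]
  · by_contra h'
    apply h
    simp only
    rw [max_eq_left (by linarith : η - dist y (x i) ≤ 0)]
    simp

lemma cone_lip (δ c : ℝ) (hc : 0 < c) (a b : E3) :
    |c * max 0 (δ - ‖a‖) - c * max 0 (δ - ‖b‖)| ≤ c * ‖a - b‖ := by
  rw [← mul_sub, abs_mul, abs_of_pos hc]
  refine mul_le_mul_of_nonneg_left ?_ hc.le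
  have h1 := norm_sub_norm_le a b
  have h2 := norm_sub_norm_le b a
  rw [norm_sub_rev b a] at h2
  have h0 := norm_nonneg (a - b)
  rcases max_cases 0 (δ - ‖a‖) with h | h <;> rcases max_cases 0 (δ - ‖b‖) with h' | h' <;>
    rw [abs_le] <;> constructor <;> linarith [h.1, h.2, h'.1, h'.2]

lemma approx_aux (f : E3 → ℝ) (hf : Continuous f) (hfi : Integrable f)
    (δ c σ : ℝ) (hc : 0 < c)
    (h1 : (∫ y : E3, c * max 0 (δ - ‖y‖)) = 1)
    (hu : ∀ a b : E3, ‖a - b‖ < δ → |f a - f b| ≤ σ)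
    {k : ℕ} (z : Fin k → E3) (η : ℝ)
    (g : Fin k → E3 → ℝ) (g0 : ∀ i y, 0 ≤ g i y) (gi : ∀ i, Integrable (g i))
    (gs : ∀ y, ∑ i, g i y = f y) (gz : ∀ i y, g i y ≠ 0 → dist y (z i) ≤ η) (y : E3) :
    |f y - ∑ i, (∫ x, g i x) * (c * max 0 (δ - ‖y - z i‖))| ≤ σ + c * η * ∫ x, f x := by
  set φ : E3 → ℝ := fun x => c * max 0 (δ - ‖x‖) with hφ
  have φc : Continuous φ := by fun_prop
  have φ0 : ∀ x, 0 ≤ φ x := fun x => mul_nonneg hc.le (le_max_left _ _)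
  have φi : Integrable φ := by
    by_contra h
    rw [integral_undef h] at h1
    exact zero_ne_one h1
  have φi' : Integrable (fun x => φ (y - x)) := φi.comp_sub_left y
  have φ1 : (∫ x, φ (y - x)) = 1 := by rw [integral_sub_left_eq_self φ volume y, h1]
  have φb : ∀ x, ‖φ x‖ ≤ c * |δ| := by
    intro x
    rw [Real.norm_eq_abs, abs_of_nonneg (φ0 x)]
    exact mul_le_mul_of_nonneg_left (max_le (abs_nonneg _)
      (by linarith [le_abs_self δ, norm_nonneg x])) hc.le
  have gφi : ∀ i, Integrable (fun x => g i x * φ (y - x)) := fun i =>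
    (gi i).mul_bdd (c := c * |δ|) (by fun_prop : Continuous fun x => φ (y - x)).aestronglyMeasurable
      (Filter.Eventually.of_forall fun x => φb _)
  have fφi : Integrable (fun x => f x * φ (y - x)) := 
    hfi.mul_bdd (c := c * |δ|) (by fun_prop : Continuous fun x => φ (y - x)).aestronglyMeasurable
      (Filter.Eventually.of_forall fun x => φb _)
  have e1 : (∑ i, ∫ x, g i x * φ (y - x)) = ∫ x, f x * φ (y - x) := by
    rw [← integral_finsetSum _ fun i _ => gφi i]
    simp only [← Finset.sum_mul, gs]
  have e2 : (∑ i, ∫ x, g i x) = ∫ x, f x := by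
    rw [← integral_finsetSum _ fun i _ => gi i]
    simp only [gs]
  have t1 : |f y - ∫ x, f x * φ (y - x)| ≤ σ := by
    have : f y - ∫ x, f x * φ (y - x) = ∫ x, (f y - f x) * φ (y - x) := by
      simp only [sub_mul]
      rw [integral_sub (φi'.const_mul _) fφi, integral_const_mul, φ1, mul_one]
    rw [this, ← Real.norm_eq_abs]
    have h := norm_integral_le_of_norm_le (φi'.const_mul σ)
      (f := fun x => (f y - f x) * φ (y - x)) (Filter.Eventually.of_forall fun x => by
        by_cases hx : ‖y - x‖ < δ
        · rw [norm_mul, Real.norm_eq_abs, Real.norm_eq_abs, abs_of_nonneg (φ0 _)]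
          exact mul_le_mul_of_nonneg_right (hu _ _ hx) (φ0 _)
        · have : φ (y - x) = 0 := by
            simp only [hφ]
            rw [max_eq_left (by linarith), mul_zero]
          simp [this])
    rwa [integral_const_mul, φ1, mul_one] at h
  have t2 : ∀ i, |(∫ x, g i x * φ (y - x)) - (∫ x, g i x) * φ (y - z i)| ≤
      c * η * ∫ x, g i x := by
    intro i
    rw [← integral_mul_const, ← integral_sub (gφi i) ((gi i).mul_const _), ← integral_const_mul,
      ← Real.norm_eq_abs]
    refine norm_integral_le_of_norm_le ((gi i).const_mul _) (Filter.Eventually.of_forall fun x => ?_)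
    rw [← mul_sub, norm_mul, Real.norm_eq_abs, Real.norm_eq_abs, abs_of_nonneg (g0 i x), mul_comm]
    by_cases hx : g i x = 0
    · simp [hx]
    · refine mul_le_mul_of_nonneg_right ?_ (g0 i x)
      refine (cone_lip δ c hc _ _).trans (mul_le_mul_of_nonneg_left ?_ hc.le)
      have := gz i x hx
      rw [dist_eq_norm, norm_sub_rev] at this
      simpa using this
  have t2' : |(∫ x, f x * φ (y - x)) - ∑ i, (∫ x, g i x) * φ (y - z i)| ≤ c * η * ∫ x, f x := by
    rw [← e1, ← e2, ← Finset.sum_sub_distrib, Finset.mul_sum]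
    exact (Finset.abs_sum_le_sum_abs _ _).trans (Finset.sum_le_sum fun i _ => t2 i)
  calc _ = |(f y - ∫ x, f x * φ (y - x)) +
        ((∫ x, f x * φ (y - x)) - ∑ i, (∫ x, g i x) * φ (y - z i))| := by
          congr 1; simp only [hφ]; ring
    _ ≤ _ := (abs_add_le _ _).trans (add_le_add t1 t2')

lemma approx (f : E3 → ℝ) (hf : Continuous f) (hf0 : ∀ y, 0 ≤ f y)
    (hne : (tsupport f).Nonempty) (hcs : HasCompactSupport f) (σ ρ : ℝ) (hσ : 0 < σ) (hρ : 0 < ρ) :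
    ∃ δ c : ℝ, 0 < δ ∧ δ ≤ ρ ∧ 0 < c ∧ (∫ y : E3, c * max 0 (δ - ‖y‖)) = 1 ∧
    ∃ (k : ℕ) (z : Fin k → E3) (m : Fin k → ℝ), 1 ≤ k ∧ (∀ i, 0 < m i) ∧
      (∀ i j, i ≠ j → ‖z i‖ ≠ ‖z j‖) ∧
      (∀ y ∈ tsupport f, ∃ i, dist y (z i) ≤ ρ) ∧
      (∀ i, ∃ y ∈ tsupport f, dist (z i) y ≤ ρ) ∧
      ∀ y, |f y - ∑ i, m i * (c * max 0 (δ - ‖y - z i‖))| ≤ 3 * σ := by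
  have hfi : Integrable f := hf.integrable_of_hasCompactSupport hcs
  obtain ⟨δ₀, hδ₀, hu⟩ := Metric.uniformContinuous_iff.1 (hcs.uniformContinuous_of_continuous hf) σ hσ
  obtain ⟨δ, hδ, hδρ, hδδ⟩ : ∃ δ : ℝ, 0 < δ ∧ δ ≤ ρ ∧ δ ≤ δ₀ :=
    ⟨min ρ δ₀, lt_min hρ hδ₀, min_le_left _ _, min_le_right _ _⟩
  obtain ⟨c, hc, h1⟩ := bump_exists δ hδ
  have hM : 0 ≤ ∫ x, f x := integral_nonneg hf0
  set M := ∫ x, f x with hMdef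
  obtain ⟨η, hη, hηρ, hησ⟩ : ∃ η : ℝ, 0 < η ∧ η ≤ ρ ∧ η ≤ σ / (c * (M + 1)) :=
    ⟨min ρ (σ / (c * (M + 1))), lt_min hρ (by positivity), min_le_left _ _, min_le_right _ _⟩
  have hη' : c * η * M ≤ σ := by
    rw [le_div_iff₀ (by positivity)] at hησ
    nlinarith [mul_pos hη hc]
  obtain ⟨t, hts, htf, htc⟩ := finite_cover_balls_of_compact (s := tsupport f) hcs (half_pos hη)
  obtain ⟨k, x, hxr⟩ : ∃ (k : ℕ) (x : Fin k → E3), Set.range x = t := by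
    have := htf.fintype
    refine ⟨Fintype.card t, fun i => ((Fintype.equivFin t).symm i : E3), ?_⟩
    ext y
    constructor
    · rintro ⟨i, rfl⟩; exact Subtype.coe_prop _
    · intro hy; exact ⟨Fintype.equivFin t ⟨y, hy⟩, by simp⟩
  have hxs : ∀ i, x i ∈ tsupport f := fun i => hts (hxr ▸ Set.mem_range_self i)
  have hcov : ∀ y ∈ tsupport f, ∃ i, dist y (x i) < η / 2 := by
    intro y hy
    obtain ⟨w, hw, hyw⟩ := Set.mem_iUnion₂.1 (htc hy)
    rw [← hxr] at hw
    obtain ⟨i, rfl⟩ := hw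
    exact ⟨i, hyw⟩
  obtain ⟨z, hzx, hzn⟩ := perturb x (η / 2) (half_pos hη)
  obtain ⟨g, g0, gi, gs, gx⟩ := pieces f hf hf0 hfi x (η / 2) hcov
  have hk : 1 ≤ k := by
    obtain ⟨y, hy⟩ := hne
    obtain ⟨i, _⟩ := hcov y hy
    exact Nat.one_le_iff_ne_zero.2 (fun h => (h ▸ i).elim0)
  have hyz : ∀ y i, dist y (x i) < η / 2 → dist y (z i) ≤ η := by
    intro y i h
    have := dist_triangle_right y (z i) (x i)
    linarith [hzx i]
  set τ : ℝ := σ / (k * (c * δ) + 1) with hτ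
  have hτ0 : 0 < τ := by positivity
  refine ⟨δ, c, hδ, hδρ, hc, h1, k, z, fun i => (∫ x, g i x) + τ, hk, fun i => ?_, hzn, ?_, ?_, ?_⟩
  · have : 0 ≤ ∫ x, g i x := integral_nonneg fun y => g0 i y
    simp only
    linarith
  · intro y hy
    obtain ⟨i, hi⟩ := hcov y hy
    exact ⟨i, (hyz y i hi).trans hηρ⟩
  · intro i
    exact ⟨x i, hxs i, by linarith [hzx i]⟩
  · intro y
    have a1 := approx_aux f hf hfi δ c σ hc h1
      (fun a b hab => by
        have := hu (a := a) (b := b) (by rw [dist_eq_norm]; linarith)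
        rw [Real.dist_eq] at this
        exact this.le) z η g g0 gi gs (fun i y h => hyz y i (gx i y h)) y
    have a2 : |∑ i : Fin k, τ * (c * max 0 (δ - ‖y - z i‖))| ≤ σ := by
      have hb : ∀ i : Fin k, |τ * (c * max 0 (δ - ‖y - z i‖))| ≤ τ * (c * δ) := by
        intro i
        rw [abs_of_nonneg (by positivity)]
        have : max 0 (δ - ‖y - z i‖) ≤ δ := max_le hδ.le (by linarith [norm_nonneg (y - z i)])
        gcongr
      refine (Finset.abs_sum_le_sum_abs _ _).trans ((Finset.sum_le_sum fun i _ => hb i).trans ?_)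
      rw [Finset.sum_const, Finset.card_univ, Fintype.card_fin, nsmul_eq_mul, hτ, div_mul_eq_mul_div,
        mul_div_assoc', div_le_iff₀ (by positivity)]
      nlinarith
    simp only [add_mul, Finset.sum_add_distrib]
    rw [← sub_sub]
    rw [abs_le] at a1 a2 ⊢
    constructor <;> linarith [a1.1, a1.2, a2.1, a2.2]

/-- Theorem 1, parts (a)–(d).  Any continuous nonnegative density `f`
with nonempty compact connected support admits a smoothed point-mass array `λ`
(with centers of pairwise distinct norms and extremal ball of radius `< ε/2`) that is
`ε`-close to `f` in `L¹`, whose support is Hausdorff-`ε`-close to that of `f`, whose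
Newtonian potential is uniformly `ε`-close to that of `f` on `B̄_N(0)`, and whose
Brillouin radius is `ε`-close to that of `f`. -/
theorem theorem1_a_to_d (f : EuclideanSpace ℝ (Fin 3) → ℝ)
    (hf : Continuous f) (hf0 : ∀ y, 0 ≤ f y)
    (hne : (tsupport f).Nonempty) (hc : IsCompact (tsupport f))
    (hconn : IsConnected (tsupport f))
    (ε N : ℝ) (hε : 0 < ε) (hN : 0 < N) :
    ∃ (k : ℕ) (_ : 1 ≤ k) (x : Fin k → EuclideanSpace ℝ (Fin 3)) (r m : Fin k → ℝ)
      (lam : Fin k → EuclideanSpace ℝ (Fin 3) → ℝ),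
      (∀ i j, i ≠ j → ‖x i‖ ≠ ‖x j‖) ∧
      (∀ i, 0 < r i) ∧ (∀ i, 0 < m i) ∧
      (∀ i, IsSmoothing (r i) (m i) (x i) (lam i)) ∧
      (∃ i₀ : Fin k, (∀ j, j ≠ i₀ → ‖x j‖ < ‖x i₀‖) ∧ r i₀ < ε / 2) ∧
      -- (a) `L¹`-closeness
      (∫ y, |f y - ∑ i, lam i y|) < ε ∧
      -- (b) Hausdorff closeness of the supports
      Metric.hausdorffDist (tsupport f) (tsupport (fun y => ∑ i, lam i y)) < ε ∧
      -- (c) uniform closeness of the potentials on `B̄_N(0)`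
      (∀ p ∈ closedBall (0 : EuclideanSpace ℝ (Fin 3)) N,
        |newtonPotential f p - newtonPotential (fun y => ∑ i, lam i y) p| < ε) ∧
      -- (d) closeness of the Brillouin radii
      |(⨆ y : tsupport f, ‖(y : EuclideanSpace ℝ (Fin 3))‖) -
        (⨆ y : tsupport (fun y => ∑ i, lam i y), ‖(y : EuclideanSpace ℝ (Fin 3))‖)| < ε := by
  have hcs : HasCompactSupport f := hc
  obtain ⟨R₀, hR₀⟩ := hc.isBounded.exists_norm_le
  obtain ⟨C, hC, hpot⟩ := pot_bound (R₀ + ε) N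
  obtain ⟨δ, c, hδ, hδρ, hcp, h1, k, z, m, hk, hm, hzn, hcov, hnear, happ⟩ :=
    approx f hf hf0 hne hcs (ε / (6 * C)) (ε / 4) (by positivity) (by positivity)
  have hs : C * (3 * (ε / (6 * C))) < ε := by
    have : C * (3 * (ε / (6 * C))) = ε / 2 := by field_simp; norm_num
    linarith
  set lam : Fin k → E3 → ℝ := fun i y => m i * (c * max 0 (δ - ‖y - z i‖)) with hlam
  have hsm : ∀ i, IsSmoothing δ (m i) (z i) (lam i) := fun i =>
    bump_smoothing δ c (m i) hδ hcp (hm i) h1 (z i)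
  have lc : ∀ i, Continuous (lam i) := fun i => (hsm i).1
  have l0 : ∀ i y, 0 ≤ lam i y := fun i => (hsm i).2.1
  set L : E3 → ℝ := fun y => ∑ i, lam i y with hL
  have Lc : Continuous L := continuous_finsetSum _ fun i _ => lc i
  have hsupp : ∀ y ∈ tsupport L, ∃ i, dist y (z i) ≤ δ := by
    have : tsupport L ⊆ ⋃ i, closedBall (z i) δ := by
      refine closure_minimal ?_ (isClosed_iUnion_of_finite fun i => isClosed_closedBall)
      intro y hy
      obtain ⟨i, _, hi⟩ := Finset.exists_ne_zero_of_sum_ne_zero hy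
      refine Set.mem_iUnion.2 ⟨i, ?_⟩
      rw [← (hsm i).2.2.2.1]
      exact subset_tsupport _ hi
    intro y hy
    obtain ⟨i, hi⟩ := Set.mem_iUnion.1 (this hy)
    exact ⟨i, hi⟩
  have hzL : ∀ i, z i ∈ tsupport L := by
    intro i
    refine subset_tsupport _ ?_
    have : 0 < L (z i) := by
      refine Finset.sum_pos' (fun j _ => l0 j _) ⟨i, Finset.mem_univ _, ?_⟩
      have : max 0 δ = δ := max_eq_right hδ.le
      simp only [hlam, sub_self, norm_zero, sub_zero, this]
      have := hm i
      positivity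
    exact this.ne'
  have H1 : ∀ y ∈ tsupport f, ∃ w ∈ tsupport L, dist y w ≤ ε / 2 := by
    intro y hy
    obtain ⟨i, hi⟩ := hcov y hy
    exact ⟨z i, hzL i, by linarith⟩
  have H2 : ∀ y ∈ tsupport L, ∃ w ∈ tsupport f, dist y w ≤ ε / 2 := by
    intro y hy
    obtain ⟨i, hi⟩ := hsupp y hy
    obtain ⟨w, hw, hiw⟩ := hnear i
    exact ⟨w, hw, by linarith [dist_triangle y (z i) w]⟩
  have LR : ∀ y ∈ tsupport L, ‖y‖ ≤ R₀ + ε := by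
    intro y hy
    obtain ⟨w, hw, h⟩ := H2 y hy
    rw [dist_eq_norm] at h
    linarith [norm_sub_norm_le y w, hR₀ w hw]
  have fR : ∀ y, R₀ + ε < ‖y‖ → f y = 0 := by
    intro y hy
    refine image_eq_zero_of_notMem_tsupport fun h => ?_
    linarith [hR₀ y h]
  have LR' : ∀ y, R₀ + ε < ‖y‖ → L y = 0 := by
    intro y hy
    refine image_eq_zero_of_notMem_tsupport fun h => ?_
    linarith [LR y h]
  have hLcs : HasCompactSupport L :=
    HasCompactSupport.intro (isCompact_closedBall 0 (R₀ + ε)) fun y hy =>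
      LR' y (by simpa using hy)
  obtain ⟨hd1, hd2⟩ := hpot (fun y => f y - L y) (3 * (ε / (6 * C))) (hf.sub Lc) (by positivity)
    happ (fun y hy => by simp [fR y hy, LR' y hy])
  have hint : ∀ u : E3 → ℝ, Continuous u → HasCompactSupport u → (∀ y, R₀ + ε < ‖y‖ → u y = 0) →
      ∀ p : E3, ‖p‖ ≤ N → Integrable (fun y => u y / ‖p - y‖) := by
    intro u hu hus huR p hp
    obtain ⟨S, hS⟩ := hus.exists_bound_of_continuous hu
    exact ((hpot u S hu ((norm_nonneg _).trans (hS 0)) hS huR).2 p hp).1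
  refine ⟨k, hk, z, fun _ => δ, m, lam, hzn, fun _ => hδ, hm, hsm, ?_, ?_, ?_, ?_, ?_⟩
  · have : Nonempty (Fin k) := ⟨⟨0, hk⟩⟩
    obtain ⟨i₀, hi₀⟩ := Finite.exists_max fun i => ‖z i‖
    exact ⟨i₀, fun j hj => lt_of_le_of_ne (hi₀ j) (hzn j i₀ hj), by linarith⟩
  · exact hd1.trans_lt hs
  · exact (hausdorffDist_le_of_mem_dist (by positivity) H1 H2).trans_lt (by linarith)
  · intro p hp
    have hp' : ‖p‖ ≤ N := by simpa using hp
    have : newtonPotential f p - newtonPotential L p = ∫ y, (f y - L y) / ‖p - y‖ := by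
      simp only [newtonPotential, sub_div]
      rw [integral_sub (hint f hf hcs fR p hp') (hint L Lc hLcs LR' p hp')]
    rw [this]
    exact (hd2 p hp').2.trans_lt hs
  · refine (sup_close (tsupport f) (tsupport L) (ε / 2) hne ⟨_, hzL ⟨0, hk⟩⟩ hc.isBounded
      hLcs.isCompact.isBounded H1 H2).trans_lt (by linarith)
end

section
/- (Core of Theorem 2.) Let e = (1,0,0) ∈ ℝ³, let λ₁ be a (3/2)-smoothing of the point mass (e, m₁) and λ₂ a (3/2)-smoothing of (−e, m₂) with m₁, m₂ > 0, and set λ = λ₁ + λ₂ and K = B̄_{3/2}(e) ∪ B̄_{3/2}(−e). Define W : ℝ³ ∖ {e, −e} → ℝ by W(x) = m₁/‖x − e‖ + m₂/‖x + e‖. Then: (i) W is real-analytic on the open set ℝ³ ∖ {e, −e}; (ii) V_λ(x) = W(x) for every x ∉ K; and (iii) every point of the frontier of K has norm > 1, so the frontier of K is contained in the open set {x | ‖x‖ > 1} ⊆ ℝ³ ∖ {e, −e} on which W is real-analytic. Hence V_λ restricted to the exterior of K extends real-analytically to a neighborhood of every point of the topography of K. -/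
open MeasureTheory Metric

/-- The kernel in cylindrical coordinates. -/
noncomputable def cylKer (a s t ρ : ℝ) : ℝ :=
  if t ^ 2 + ρ ^ 2 ≤ s ^ 2 then (Real.sqrt ((a - t) ^ 2 + ρ ^ 2))⁻¹ else 0

lemma inner_int (b w : ℝ) (hb : 0 < b) (hw : 0 ≤ w) :
    ∫ ρ in (0:ℝ)..w, ρ * (Real.sqrt (b ^ 2 + ρ ^ 2))⁻¹ = Real.sqrt (b ^ 2 + w ^ 2) - b := by
  have hpos : ∀ ρ : ℝ, 0 < b ^ 2 + ρ ^ 2 := fun ρ => by positivity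
  rw [intervalIntegral.integral_eq_sub_of_hasDerivAt (f := fun ρ => Real.sqrt (b ^ 2 + ρ ^ 2))]
  · simp [Real.sqrt_sq hb.le]
  · intro ρ _
    have h : HasDerivAt (fun ρ : ℝ => b ^ 2 + ρ ^ 2) (2 * ρ) ρ := by
      simpa using (hasDerivAt_pow 2 ρ).const_add (b ^ 2)
    refine (h.sqrt (hpos ρ).ne').congr_deriv ?_
    rw [mul_div_mul_left _ _ two_ne_zero, div_eq_mul_inv]
  · apply Continuous.intervalIntegrable
    refine continuous_id.mul (Continuous.inv₀ (by fun_prop) ?_)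
    intro ρ
    exact (Real.sqrt_pos.2 (hpos ρ)).ne'

lemma outer_int (a s : ℝ) (hs : 0 ≤ s) (has : s < a) :
    ∫ t in (-s)..s, (Real.sqrt (s ^ 2 + a ^ 2 - 2 * a * t) - (a - t)) = 2 * s ^ 3 / (3 * a) := by
  have ha : 0 < a := hs.trans_lt has
  have hpos : ∀ t ≤ s, 0 < s ^ 2 + a ^ 2 - 2 * a * t := fun t ht => by
    nlinarith [mul_pos (sub_pos.2 has) (sub_pos.2 has)]
  rw [intervalIntegral.integral_eq_sub_of_hasDerivAt
    (f := fun t => -(1 / (3 * a)) * ((s ^ 2 + a ^ 2 - 2 * a * t) *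
      Real.sqrt (s ^ 2 + a ^ 2 - 2 * a * t)) - (a * t - t ^ 2 / 2))]
  · have e1 : s ^ 2 + a ^ 2 - 2 * a * s = (a - s) ^ 2 := by ring
    have e2 : s ^ 2 + a ^ 2 - 2 * a * (-s) = (a + s) ^ 2 := by ring
    simp only [e1, e2]
    rw [Real.sqrt_sq (by linarith), Real.sqrt_sq (by linarith)]
    field_simp
    ring
  · intro t ht
    rw [Set.uIcc_of_le (by linarith)] at ht
    have h0 := hpos t ht.2
    have h : HasDerivAt (fun t : ℝ => s ^ 2 + a ^ 2 - 2 * a * t) (-(2 * a)) t := by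
      simpa using ((hasDerivAt_id t).const_mul (2 * a)).const_sub (s ^ 2 + a ^ 2)
    have h3 := ((h.mul (h.sqrt h0.ne')).const_mul (-(1 / (3 * a)))).sub
      (((hasDerivAt_id t).const_mul a).sub ((hasDerivAt_pow 2 t).div_const 2))
    refine HasDerivAt.congr_deriv h3 ?_
    have hq := (Real.sqrt_pos.2 h0)
    have hq2 := Real.sq_sqrt h0.le
    set q := Real.sqrt (s ^ 2 + a ^ 2 - 2 * a * t)
    rw [← hq2]
    simp only [Nat.add_one_sub_one, pow_one, Nat.cast_ofNat]
    field_simp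
    ring
  · apply Continuous.intervalIntegrable
    fun_prop

lemma slice_int (a s t : ℝ) (hs : 0 ≤ s) (has : s < a) :
    ∫ v : EuclideanSpace ℝ (Fin 2), cylKer a s t ‖v‖ =
      (Set.Icc (-s) s).indicator
        (fun t => 2 * Real.pi * (Real.sqrt (s ^ 2 + a ^ 2 - 2 * a * t) - (a - t))) t := by
  rw [integral_fun_norm_addHaar volume (cylKer a s t)]
  have hv : (volume : Measure (EuclideanSpace ℝ (Fin 2))).real (ball 0 1) = Real.pi := by
    rw [Measure.real, EuclideanSpace.volume_ball_fin_two]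
    simp [Real.pi_pos.le]
  rw [hv]
  simp only [finrank_euclideanSpace, Fintype.card_fin, smul_eq_mul, nsmul_eq_mul, pow_one,
    Nat.add_one_sub_one]
  by_cases ht : t ∈ Set.Icc (-s) s
  · rw [Set.indicator_of_mem ht]
    have hts : t ^ 2 ≤ s ^ 2 := by
      rw [sq_le_sq, abs_of_nonneg hs]; exact abs_le.2 ht
    set w := Real.sqrt (s ^ 2 - t ^ 2) with hw
    have hw0 : 0 ≤ w := Real.sqrt_nonneg _
    have hw2 : w ^ 2 = s ^ 2 - t ^ 2 := Real.sq_sqrt (by linarith)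
    have hI : ∫ ρ in Set.Ioi (0:ℝ), ρ ^ (2 - 1) * cylKer a s t ρ
        = ∫ ρ in (0:ℝ)..w, ρ * (Real.sqrt ((a - t) ^ 2 + ρ ^ 2))⁻¹ := by
      rw [intervalIntegral.integral_of_le hw0, ← integral_indicator measurableSet_Ioi,
        ← integral_indicator measurableSet_Ioc]
      congr 1
      ext ρ
      by_cases h0 : 0 < ρ
      · have hiff : t ^ 2 + ρ ^ 2 ≤ s ^ 2 ↔ ρ ≤ w := by
          rw [← abs_of_pos h0, ← abs_of_nonneg hw0, ← sq_le_sq, hw2, abs_of_pos h0]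
          constructor <;> intro <;> linarith
        by_cases h1 : ρ ≤ w
        · simp [Set.indicator, h0, h1, cylKer, hiff]
        · simp [Set.indicator, h0, h1, cylKer, hiff]
      · simp [Set.indicator, h0]
    simp only [Nat.add_one_sub_one, pow_one] at hI
    rw [hI, inner_int (a - t) w (by linarith [ht.2]) hw0, hw2]
    have : (a - t) ^ 2 + (s ^ 2 - t ^ 2) = s ^ 2 + a ^ 2 - 2 * a * t := by ring
    rw [this]
    push_cast
    ring
  · rw [Set.indicator_of_notMem ht]
    have : ∀ ρ, cylKer a s t ρ = 0 := by
      intro ρ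
      rw [cylKer, if_neg]
      intro h
      apply ht
      rw [Set.mem_Icc, ← abs_le, ← abs_of_nonneg hs, ← sq_le_sq]
      simpa using (by nlinarith [sq_nonneg ρ] : t ^ 2 ≤ s ^ 2)
    simp [this]

lemma exists_isom (x : EuclideanSpace ℝ (Fin 3)) (hx : x ≠ 0) :
    ∃ φ : EuclideanSpace ℝ (Fin 3) ≃ₗᵢ[ℝ] WithLp 2 (ℝ × EuclideanSpace ℝ (Fin 2)),
      φ x = WithLp.toLp 2 (‖x‖, 0) := by
  have hn : ‖x‖ ≠ 0 := norm_ne_zero_iff.2 hx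
  obtain ⟨b, hb⟩ := Orthonormal.exists_orthonormalBasis_extension_of_card_eq (𝕜 := ℝ)
    (E := EuclideanSpace ℝ (Fin 3)) (ι := Fin 3) (by simp) (v := fun _ => ‖x‖⁻¹ • x) (s := {0})
    (by
      constructor
      · intro i; simp [norm_smul, hn]
      · intro i j hij; exact absurd (Subsingleton.elim i j) hij)
  obtain ⟨c, hc⟩ := Orthonormal.exists_orthonormalBasis_extension_of_card_eq (𝕜 := ℝ)
    (E := WithLp 2 (ℝ × EuclideanSpace ℝ (Fin 2))) (ι := Fin 3)
    (by
      rw [(WithLp.linearEquiv 2 ℝ (ℝ × EuclideanSpace ℝ (Fin 2))).finrank_eq]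
      simp) (v := fun _ => WithLp.toLp 2 ((1:ℝ), 0)) (s := {0})
    (by
      constructor
      · intro i; simp
      · intro i j hij; exact absurd (Subsingleton.elim i j) hij)
  refine ⟨b.equiv c (Equiv.refl _), ?_⟩
  have h0 := hb 0 rfl
  have h1 := hc 0 rfl
  have h2 : x = ‖x‖ • b 0 := by rw [h0, smul_smul, mul_inv_cancel₀ hn, one_smul]
  conv_lhs => rw [h2]
  rw [map_smul, OrthonormalBasis.equiv_apply_basis, Equiv.refl_apply, h1, ← WithLp.toLp_smul]
  simp

lemma ball_int (x : EuclideanSpace ℝ (Fin 3)) (s : ℝ) (hs : 0 ≤ s) (hsx : s < ‖x‖) :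
    IntegrableOn (fun y => ‖x - y‖⁻¹) (closedBall 0 s) ∧
    ∫ y in closedBall 0 s, ‖x - y‖⁻¹ = Real.pi * 4 / 3 * s ^ 3 / ‖x‖ := by
  have hx : x ≠ 0 := norm_pos_iff.1 (hs.trans_lt hsx)
  have hint : IntegrableOn (fun y => ‖x - y‖⁻¹) (closedBall 0 s) := by
    apply ContinuousOn.integrableOn_compact (isCompact_closedBall 0 s)
    apply ContinuousOn.inv₀ (by fun_prop)
    intro y hy h
    rw [norm_eq_zero, sub_eq_zero] at h
    rw [← h, mem_closedBall_zero_iff] at hy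
    linarith
  refine ⟨hint, ?_⟩
  obtain ⟨φ, hφ⟩ := exists_isom x hx
  set a := ‖x‖ with ha
  have hmp := (WithLp.volume_preserving_ofLp ℝ (EuclideanSpace ℝ (Fin 2))).comp φ.measurePreserving
  have hemb : MeasurableEmbedding ((@WithLp.ofLp 2 (ℝ × EuclideanSpace ℝ (Fin 2))) ∘ φ) :=
    (MeasurableEquiv.toLp 2 _).symm.measurableEmbedding.comp
      φ.toHomeomorph.measurableEmbedding
  let F : ℝ × EuclideanSpace ℝ (Fin 2) → ℝ := fun p => cylKer a s p.1 ‖p.2‖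
  have hF : ∀ y, (closedBall 0 s).indicator (fun y => ‖x - y‖⁻¹) y
      = F (((@WithLp.ofLp 2 (ℝ × EuclideanSpace ℝ (Fin 2))) ∘ φ) y) := by
    intro y
    have e1 : ‖y‖ ^ 2 = (φ y).fst ^ 2 + ‖(φ y).snd‖ ^ 2 := by
      rw [← φ.norm_map y, WithLp.prod_norm_sq_eq_of_L2]; simp
    have e2 : ‖x - y‖ ^ 2 = (a - (φ y).fst) ^ 2 + ‖(φ y).snd‖ ^ 2 := by
      rw [← φ.norm_map (x - y), WithLp.prod_norm_sq_eq_of_L2, map_sub, hφ]; simp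
    have e3 : y ∈ closedBall 0 s ↔ ‖y‖ ^ 2 ≤ s ^ 2 := by
      rw [mem_closedBall_zero_iff, sq_le_sq, abs_of_nonneg hs, abs_of_nonneg (norm_nonneg y)]
    have e4 : F (((@WithLp.ofLp 2 (ℝ × EuclideanSpace ℝ (Fin 2))) ∘ φ) y)
      = if ‖y‖ ^ 2 ≤ s ^ 2 then (Real.sqrt (‖x - y‖ ^ 2))⁻¹ else 0 := by
      rw [e1, e2]; rfl
    rw [e4, Real.sqrt_sq (norm_nonneg _), Set.indicator]
    simp only [e3]
  have hFi : Integrable F (volume.prod volume) := by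
    have := (integrable_indicator_iff measurableSet_closedBall).2 hint
    rw [show (closedBall 0 s).indicator (fun y => ‖x - y‖⁻¹) = F ∘ _ from funext hF] at this
    exact (hmp.integrable_comp_emb hemb).1 this
  rw [← integral_indicator measurableSet_closedBall]
  simp_rw [hF]
  rw [hmp.integral_comp hemb F, Measure.volume_eq_prod, integral_prod _ hFi]
  simp only [F]
  simp_rw [slice_int a s _ hs hsx]
  rw [integral_indicator measurableSet_Icc, integral_Icc_eq_integral_Ioc,
    ← intervalIntegral.integral_of_le (by linarith), intervalIntegral.integral_const_mul,
    outer_int a s hs hsx]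
  have : a ≠ 0 := by positivity
  field_simp
  ring

lemma shell (x : EuclideanSpace ℝ (Fin 3)) (r : ℝ) (hr : 0 ≤ r) (hrx : r < ‖x‖)
    (lam : EuclideanSpace ℝ (Fin 3) → ℝ) (hc : Continuous lam)
    (hrad : ∀ y z, ‖y‖ = ‖z‖ → lam y = lam z) (hsupp : tsupport lam = closedBall 0 r) :
    Integrable (fun y => lam y / ‖x - y‖) ∧
    ∫ y, lam y / ‖x - y‖ = (∫ y, lam y) / ‖x‖ := by
  have hz : ∀ y, y ∉ closedBall (0 : EuclideanSpace ℝ (Fin 3)) r → lam y = 0 := by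
    intro y hy
    rw [← hsupp] at hy
    exact image_eq_zero_of_notMem_tsupport hy
  have hx0 : 0 < ‖x‖ := hr.trans_lt hrx
  constructor
  · rw [← integrableOn_iff_integrable_of_support_subset (s := closedBall 0 r)]
    · apply ContinuousOn.integrableOn_compact (isCompact_closedBall 0 r)
      apply ContinuousOn.div (by fun_prop) (by fun_prop)
      intro y hy h
      rw [norm_eq_zero, sub_eq_zero] at h
      rw [← h, mem_closedBall_zero_iff] at hy
      linarith
    · intro y hy
      by_contra h
      exact hy (by simp [hz y h])
  let ν : Measure (EuclideanSpace ℝ (Fin 3)) := volume.restrict (closedBall 0 r)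
  let d : EuclideanSpace ℝ (Fin 3) → ENNReal := fun y => ENNReal.ofReal ‖x - y‖⁻¹
  have hd : Measurable d := by fun_prop
  let μ₁ : Measure ℝ := (ν.withDensity d).map norm
  let μ₂ : Measure ℝ := (ν.withDensity (fun _ => ENNReal.ofReal ‖x‖⁻¹)).map norm
  have hval : ∀ s, 0 ≤ s → s < ‖x‖ → ∫⁻ y in closedBall 0 s, d y
      = ENNReal.ofReal (Real.pi * 4 / 3 * s ^ 3 / ‖x‖) := by
    intro s hs hsx
    obtain ⟨h1, h2⟩ := ball_int x s hs hsx
    rw [← h2, ofReal_integral_eq_lintegral_ofReal h1 (Filter.Eventually.of_forall (by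
      intro y; simp))]
  have key : μ₁ = μ₂ := by
    have : IsFiniteMeasure (ν.withDensity d) := by
      apply isFiniteMeasure_withDensity
      show ∫⁻ y in closedBall 0 r, d y ≠ _
      rw [hval r hr hrx]
      exact ENNReal.ofReal_ne_top
    have : IsFiniteMeasure μ₁ := Measure.isFiniteMeasure_map _ _
    apply Measure.ext_of_Iic
    intro s
    have hpre : (norm ⁻¹' Set.Iic s : Set (EuclideanSpace ℝ (Fin 3))) = closedBall 0 s := by
      ext y; simp
    have hinter : closedBall (0 : EuclideanSpace ℝ (Fin 3)) s ∩ closedBall 0 r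
        = closedBall 0 (min s r) := by
      ext y; simp
    simp only [μ₁, μ₂]
    rw [Measure.map_apply measurable_norm measurableSet_Iic,
      Measure.map_apply measurable_norm measurableSet_Iic, hpre,
      withDensity_apply _ measurableSet_closedBall, withDensity_apply _ measurableSet_closedBall]
    simp only [ν]
    rw [Measure.restrict_restrict measurableSet_closedBall, hinter]
    rcases lt_or_ge s 0 with hs | hs
    · rw [closedBall_eq_empty.2 (by simp [hs])]
      simp
    · have hm : 0 ≤ min s r := le_min hs hr
      rw [hval _ hm ((min_le_right _ _).trans_lt hrx), setLIntegral_const,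
        EuclideanSpace.volume_closedBall_fin_three, ← ENNReal.ofReal_pow hm,
        ← ENNReal.ofReal_mul (by positivity), ← ENNReal.ofReal_mul (by positivity)]
      congr 1
      ring
  let u : EuclideanSpace ℝ (Fin 3) := EuclideanSpace.single 0 1
  let g : ℝ → ℝ := fun t => lam (t • u)
  have hg : Continuous g := by fun_prop
  have hgl : ∀ y, g ‖y‖ = lam y := by
    intro y
    apply hrad
    simp [norm_smul, u]
  have i1 : ∫ t, g t ∂μ₁ = ∫ y, lam y / ‖x - y‖ := by
    rw [integral_map measurable_norm.aemeasurable hg.aestronglyMeasurable]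
    simp_rw [hgl]
    rw [integral_withDensity_eq_integral_toReal_smul hd (by simp [d])]
    rw [← setIntegral_eq_integral_of_forall_compl_eq_zero (s := closedBall 0 r)
      (f := fun y => lam y / ‖x - y‖) (fun y hy => by simp [hz y hy])]
    congr 1
    ext y
    simp [d, div_eq_inv_mul]
  have i2 : ∫ t, g t ∂μ₂ = (∫ y, lam y) / ‖x‖ := by
    rw [integral_map measurable_norm.aemeasurable hg.aestronglyMeasurable]
    simp_rw [hgl]
    rw [integral_withDensity_eq_integral_toReal_smul measurable_const (by simp)]
    rw [← setIntegral_eq_integral_of_forall_compl_eq_zero (s := closedBall 0 r)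
      (f := lam) (fun y hy => hz y hy), integral_smul]
    simp [ν, div_eq_inv_mul]
  rw [← i1, key, i2]

lemma shell_center (c x : EuclideanSpace ℝ (Fin 3)) (r m : ℝ) (hr : 0 ≤ r) (hrx : r < ‖x - c‖)
    (lam : EuclideanSpace ℝ (Fin 3) → ℝ) (h : IsSmoothing r m c lam) :
    Integrable (fun y => lam y / ‖x - y‖) ∧ ∫ y, lam y / ‖x - y‖ = m / ‖x - c‖ := by
  obtain ⟨hc, -, hrad, hsupp, hm⟩ := h
  obtain ⟨h1, h2⟩ := shell (x - c) r hr hrx (fun y => lam (y + c)) (by fun_prop)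
    (fun y z hyz => hrad _ _ (by simpa using hyz))
    (by
      have := tsupport_comp_eq_preimage lam (Homeomorph.addRight c)
      change tsupport (fun y => lam (y + c)) = _ at this
      rw [this, hsupp]
      ext y
      simp [dist_eq_norm])
  rw [integral_add_right_eq_self lam c, hm] at h2
  have e : (fun y => lam (y + c) / ‖x - c - y‖) = fun y => (fun z => lam z / ‖x - z‖) (y + c) := by
    ext y
    simp only [sub_sub, add_comm c y]
  rw [e] at h1 h2
  rw [integral_add_right_eq_self (fun z => lam z / ‖x - z‖) c] at h2
  refine ⟨?_, h2⟩
  have := h1.comp_add_right (-c)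
  simpa using this

lemma analytic_inv_norm (m : ℝ) (c x : EuclideanSpace ℝ (Fin 3)) (hx : x ≠ c) :
    AnalyticAt ℝ (fun x => m / ‖x - c‖) x := by
  have h0 : x - c ≠ 0 := sub_ne_zero.2 hx
  have h1 : ContDiffAt ℝ ⊤ (fun x : EuclideanSpace ℝ (Fin 3) => ‖x - c‖) x :=
    ContDiffAt.norm ℝ (by fun_prop) h0
  exact analyticAt_const.div h1.analyticAt (norm_ne_zero_iff.2 h0)

/-- Core of Theorem 2.  For `λ = λ₁ + λ₂` a sum of two
`(3/2)`-smoothings of the point masses `(±e, m₁), (∓e, m₂)` and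
`K = B̄_{3/2}(e) ∪ B̄_{3/2}(-e)`, the two-point-mass potential
`W(x) = m₁/‖x - e‖ + m₂/‖x + e‖` is real-analytic off `{e, -e}`, agrees with `V_λ`
outside `K`, and every point of the frontier of `K` has norm `> 1`, hence lies in the
open region `{‖x‖ > 1} ⊆ ℝ³ ∖ {e, -e}` where `W` is real-analytic. -/
theorem theorem2_core (m₁ m₂ : ℝ) (hm₁ : 0 < m₁) (hm₂ : 0 < m₂)
    (e : EuclideanSpace ℝ (Fin 3)) (he : e = EuclideanSpace.single 0 1)
    (lam₁ lam₂ : EuclideanSpace ℝ (Fin 3) → ℝ)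
    (h₁ : IsSmoothing (3 / 2) m₁ e lam₁)
    (h₂ : IsSmoothing (3 / 2) m₂ (-e) lam₂)
    (K : Set (EuclideanSpace ℝ (Fin 3)))
    (hK : K = closedBall e (3 / 2) ∪ closedBall (-e) (3 / 2))
    (W : EuclideanSpace ℝ (Fin 3) → ℝ)
    (hW : W = fun x => m₁ / ‖x - e‖ + m₂ / ‖x + e‖) :
    -- (i) `W` is real-analytic off the two centers
    AnalyticOnNhd ℝ W ({e, -e}ᶜ) ∧
    -- (ii) `V_λ = W` outside `K`
    (∀ x ∉ K, newtonPotential (fun y => lam₁ y + lam₂ y) x = W x) ∧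
    -- (iii) the frontier of `K` lies in `{x | 1 < ‖x‖}`, a subset of `{e, -e}ᶜ`
    (∀ x ∈ frontier K, 1 < ‖x‖) ∧
    {x : EuclideanSpace ℝ (Fin 3) | 1 < ‖x‖} ⊆ ({e, -e}ᶜ : Set (EuclideanSpace ℝ (Fin 3))) := by
  have hne : ‖e‖ = 1 := by rw [he]; simp
  refine ⟨?_, ?_, ?_, ?_⟩
  · intro x hx
    simp only [Set.mem_compl_iff, Set.mem_insert_iff, Set.mem_singleton_iff, not_or] at hx
    rw [hW]
    have := (analytic_inv_norm m₁ e x hx.1).add (analytic_inv_norm m₂ (-e) x hx.2)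
    simp only [sub_neg_eq_add] at this
    exact this
  · intro x hx
    rw [hK, Set.mem_union, not_or, mem_closedBall, mem_closedBall, dist_eq_norm, dist_eq_norm,
      not_le, not_le] at hx
    obtain ⟨a1, a2⟩ := shell_center e x _ m₁ (by norm_num) hx.1 lam₁ h₁
    obtain ⟨b1, b2⟩ := shell_center (-e) x _ m₂ (by norm_num) hx.2 lam₂ h₂
    rw [newtonPotential, hW]
    simp only [add_div]
    rw [integral_add a1 b1, a2, b2, sub_neg_eq_add]
  · intro x hx
    have hint : ∀ c : EuclideanSpace ℝ (Fin 3), closedBall c (3 / 2) ⊆ K →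
        3 / 2 ≤ ‖x - c‖ := by
      intro c hc
      by_contra! h
      refine hx.2 (mem_interior.2 ⟨ball c (3 / 2), ball_subset_closedBall.trans hc, isOpen_ball, ?_⟩)
      rwa [mem_ball, dist_eq_norm]
    have c1 := hint e (by rw [hK]; exact Set.subset_union_left)
    have c2 := hint (-e) (by rw [hK]; exact Set.subset_union_right)
    rw [sub_neg_eq_add] at c2
    have := parallelogram_law_with_norm ℝ x e
    rw [hne] at this
    nlinarith [norm_nonneg x]
  · intro x hx
    simp only [Set.mem_ofPred_eq] at hx
    simp only [Set.mem_compl_iff, Set.mem_insert_iff, Set.mem_singleton_iff, not_or]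
    constructor <;> rintro rfl <;> simp [hne] at hx
end

section
/- Let f : ℝ³ → ℝ be continuous with compact support. Then the Newtonian potential V_f is real-analytic on the open set ℝ³ ∖ supp f. -/
open MeasureTheory

section NewtonAux
open Topology Filter

lemma newton_sqrt_aux {A : Type*} [NormedCommRing A] [NormedAlgebra ℝ A] [CompleteSpace A]
    (u : Aˣ) : ∃ S : A → A, AnalyticAt ℝ S ((u : A) * u) ∧ ∀ᶠ h in 𝓝 (u : A), S (h * h) = h := by
  set F : A → A := fun h => h * h with hF
  have hFa : AnalyticAt ℝ F u := analyticAt_id.mul analyticAt_id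
  have h1 : ∀ a : A, (1/2 : ℝ) • ((↑u⁻¹ : A) * ((2:ℝ) • ((u:A) * a))) = a := by
    intro a
    rw [mul_smul_comm, smul_smul, ← mul_assoc, Units.inv_mul]; norm_num
  have h2 : ∀ a : A, (2 : ℝ) • ((u : A) * ((1/2:ℝ) • ((↑u⁻¹:A) * a))) = a := by
    intro a
    rw [mul_smul_comm, smul_smul, ← mul_assoc, Units.mul_inv]; norm_num
  let i : A ≃L[ℝ] A := ContinuousLinearEquiv.equivOfInverse
    ((2:ℝ) • ContinuousLinearMap.mul ℝ A (u : A))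
    ((1/2:ℝ) • ContinuousLinearMap.mul ℝ A (↑u⁻¹ : A))
    (fun a => by simpa using h1 a) (fun a => by simpa using h2 a)
  have hd : HasStrictFDerivAt F (i : A →L[ℝ] A) u := by
    have := (hasStrictFDerivAt_id (𝕜 := ℝ) (u : A)).mul (hasStrictFDerivAt_id (𝕜 := ℝ) (u : A))
    have e : (i : A →L[ℝ] A) = (u : A) • ContinuousLinearMap.id ℝ A
        + (u : A) • ContinuousLinearMap.id ℝ A := by
      ext a
      show (2:ℝ) • ((u : A) * a) = (u : A) * a + (u : A) * a
      rw [two_smul]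
    rw [e]
    exact this
  let R := hd.toOpenPartialHomeomorph F
  have hx : (u : A) ∈ R.source := hd.mem_toOpenPartialHomeomorph_source
  obtain ⟨p, hp⟩ := hFa
  refine ⟨R.symm, ?_, hd.eventually_left_inverse⟩
  have := R.hasFPowerSeriesAt_symm hx hp (i := i) ?_ |>.analyticAt
  · exact this
  · have e := hp.hasStrictFDerivAt.hasFDerivAt.unique hd.hasFDerivAt
    rw [← e]
    ext a
    simp

variable {K : Set (EuclideanSpace ℝ (Fin 3))}

noncomputable def newtonN (K : Set (EuclideanSpace ℝ (Fin 3))) (x : EuclideanSpace ℝ (Fin 3)) : C(K, ℝ) :=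
  ⟨fun y => ‖x - y‖, by fun_prop⟩

noncomputable def newtonC (K : Set (EuclideanSpace ℝ (Fin 3))) (i : Fin 3) : C(K, ℝ) :=
  ⟨fun y => (y : EuclideanSpace ℝ (Fin 3)) i, by fun_prop⟩

lemma newtonN_mul (x : EuclideanSpace ℝ (Fin 3)) :
    newtonN K x * newtonN K x =
      ∑ i, (x i • (1 : C(K, ℝ)) - newtonC K i) * (x i • (1 : C(K, ℝ)) - newtonC K i) := by
  ext y
  simp [newtonN, newtonC, ContinuousMap.sum_apply, ← pow_two, EuclideanSpace.norm_sq_eq]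

lemma newtonN_continuous [CompactSpace K] : Continuous (newtonN K) := by
  refine ContinuousMap.continuous_of_continuous_uncurry _ ?_
  show Continuous fun p : EuclideanSpace ℝ (Fin 3) × K => ‖p.1 - p.2‖
  fun_prop

lemma newtonN_analytic [CompactSpace K] (x₀ : EuclideanSpace ℝ (Fin 3)) (hx : x₀ ∉ K) :
    IsUnit (newtonN K x₀) ∧ AnalyticAt ℝ (newtonN K) x₀ := by
  have hu : IsUnit (newtonN K x₀) := by
    rw [ContinuousMap.isUnit_iff_forall_ne_zero]
    intro y
    show ‖x₀ - y‖ ≠ 0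
    rw [norm_ne_zero_iff, sub_ne_zero]
    rintro rfl
    exact hx y.2
  refine ⟨hu, ?_⟩
  obtain ⟨S, hS, hS'⟩ := newton_sqrt_aux hu.unit
  have hq : AnalyticAt ℝ (fun x => newtonN K x * newtonN K x) x₀ := by
    simp_rw [newtonN_mul]
    have hc : ∀ i : Fin 3, AnalyticAt ℝ
        (fun x : EuclideanSpace ℝ (Fin 3) => x i • (1 : C(K, ℝ)) - newtonC K i) x₀ := fun i =>
      (((EuclideanSpace.proj i : EuclideanSpace ℝ (Fin 3) →L[ℝ] ℝ).analyticAt x₀).smul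
        analyticAt_const).sub analyticAt_const
    exact Finset.analyticAt_fun_sum _ fun i _ => (hc i).mul (hc i)
  have hcomp : AnalyticAt ℝ (fun x => S (newtonN K x * newtonN K x)) x₀ :=
    AnalyticAt.fun_comp (by simpa using hS) hq
  refine hcomp.congr ?_
  exact newtonN_continuous.continuousAt.eventually hS'

end NewtonAux

/-- The Newtonian potential `V_f(x) = ∫ f(y)/‖x - y‖ dy` of a
continuous compactly supported density `f` on `ℝ³` is real-analytic on the complement
of the support of `f`. -/
theorem newton_potential_analytic_off_support (f : EuclideanSpace ℝ (Fin 3) → ℝ)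
    (hf : Continuous f) (hsupp : HasCompactSupport f) :
    AnalyticOnNhd ℝ (fun x => ∫ y, f y / ‖x - y‖) (tsupport f)ᶜ := by
  intro x₀ hx₀
  set K := tsupport f with hK
  have : CompactSpace K := isCompact_iff_compactSpace.mp hsupp
  have hKm : MeasurableSet K := (isClosed_tsupport f).measurableSet
  let μ : Measure K := Measure.comap Subtype.val volume
  have : IsFiniteMeasure μ := ⟨by
    rw [comap_subtype_coe_apply hKm]
    simpa using hsupp.isCompact.measure_lt_top⟩
  let fK : C(K, ℝ) := ⟨fun y => f y, by fun_prop⟩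
  have hint : ∀ g : C(K, ℝ), Integrable (fun y => g y) μ := fun g =>
    g.continuous.integrable_of_hasCompactSupport (HasCompactSupport.of_compactSpace _)
  let L₀ : C(K, ℝ) →ₗ[ℝ] ℝ :=
    { toFun := fun g => ∫ y, g y ∂μ
      map_add' := fun g h => integral_add (hint g) (hint h)
      map_smul' := fun c g => integral_const_mul c _ }
  let L : C(K, ℝ) →L[ℝ] ℝ := L₀.mkContinuous (μ.real Set.univ) (fun g => by
    rw [mul_comm]
    exact norm_integral_le_of_norm_le_const (Filter.Eventually.of_forall fun y => g.norm_coe_le_norm y))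
  obtain ⟨hu, ha⟩ := newtonN_analytic x₀ hx₀
  have hinv : AnalyticAt ℝ (fun x => L (fK * Ring.inverse (newtonN K x))) x₀ := by
    refine (L.analyticAt _).fun_comp (analyticAt_const.mul ?_)
    exact AnalyticAt.fun_comp (analyticOnNhd_inverse (𝕜 := ℝ) _ hu) ha
  refine hinv.congr ?_
  filter_upwards [(isClosed_tsupport f).isOpen_compl.mem_nhds hx₀] with x hx
  have hux := (newtonN_analytic (K := K) x hx).1
  have key : ∀ y : K, (fK * Ring.inverse (newtonN K x)) y = f y / ‖x - y‖ := by
    intro y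
    have h1 : (newtonN K x * Ring.inverse (newtonN K x)) y = 1 := by
      rw [Ring.mul_inverse_cancel _ hux]; rfl
    have h2 : ‖x - y‖ * (Ring.inverse (newtonN K x)) y = 1 := h1
    show f y * (Ring.inverse (newtonN K x)) y = _
    rw [eq_div_iff (left_ne_zero_of_mul_eq_one h2), mul_assoc, mul_comm _ ‖x - y‖, h2, mul_one]
  show ∫ y, (fK * Ring.inverse (newtonN K x)) y ∂μ = _
  simp_rw [key]
  rw [integral_subtype_comap hKm (fun y => f y / ‖x - y‖)]
  refine setIntegral_eq_integral_of_forall_compl_eq_zero fun y hy => ?_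
  rw [image_eq_zero_of_notMem_tsupport hy, zero_div]
end
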